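/- Rate function identification: let u ∈ P over x ∈ M and Q^{u,a} = {h ∈ H^d : ψ(h)_1 = a}, where ψ(h) is the projection to M of the solution of dφ_t = Σ_{i=1}^d A_i(φ_t)dh_t^i, φ_0 = u. Then Q^{u,a} is nonempty, and min{ ‖h‖²_{H}/2 : h ∈ Q^{u,a} } exists and equals d_{SR}(x,a)²/2. -/

import Mathlib

/- STATEMENT 16: Rate function identification.  With `u` a frame over `x` on the
adapted orthonormal frame bundle `P` (modelled, as throughout, inside a
Euclidean space with smooth projection `π`), `ψ(h)` the projection to `M` of
the solution of `dφ_t = Σ A_i(φ_t) dh_t^i`, `φ_0 = u`, and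
`Q^{u,a} = {h ∈ H^d : ψ(h)_1 = a}`: the set `Q^{u,a}` is nonempty and
`min{ ‖h‖²_H / 2 : h ∈ Q^{u,a} }` exists and equals `d_{SR}(x,a)²/2`. -/

noncomputable section
open Set MeasureTheory

abbrev EucSp (N : ℕ) : Type := EuclideanSpace ℝ (Fin N)

structure SRData (N : ℕ) where
  M : Set (EucSp N)
  compactM : IsCompact M
  tangent : EucSp N → Submodule ℝ (EucSp N)
  D : EucSp N → Submodule ℝ (EucSp N)
  D_le_tangent : ∀ x, D x ≤ tangent x
  g : EucSp N → EucSp N → EucSp N → ℝ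
  g_symm : ∀ x v w, g x v w = g x w v
  g_addl : ∀ x u v w, g x (u + v) w = g x u w + g x v w
  g_smull : ∀ x (c : ℝ) v w, g x (c • v) w = c * g x v w
  g_posdef : ∀ x v, v ∈ D x → v ≠ 0 → 0 < g x v v

def μ01 : Measure ℝ := volume.restrict (Set.Ioc (0:ℝ) 1)

structure AdmPath {N : ℕ} (S : SRData N) (x y : EucSp N) where
  γ : ℝ → EucSp N
  v : ℝ → EucSp N
  start : γ 0 = x
  endpt : γ 1 = y
  memM : ∀ t ∈ Set.Icc (0:ℝ) 1, γ t ∈ S.M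
  vInt : IntegrableOn v (Set.Ioc (0:ℝ) 1)
  rep : ∀ t ∈ Set.Icc (0:ℝ) 1, γ t = x + ∫ s in Set.Ioc (0:ℝ) t, v s
  horiz : ∀ᵐ t ∂μ01, v t ∈ S.D (γ t)
  energyInt : IntegrableOn (fun t => S.g (γ t) (v t) (v t)) (Set.Ioc (0:ℝ) 1)

def AdmPath.energy {N : ℕ} {S : SRData N} {x y : EucSp N} (p : AdmPath S x y) : ℝ :=
  ∫ t in Set.Ioc (0:ℝ) 1, S.g (p.γ t) (p.v t) (p.v t)

def AdmPath.length {N : ℕ} {S : SRData N} {x y : EucSp N} (p : AdmPath S x y) : ℝ :=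
  ∫ t in Set.Ioc (0:ℝ) 1, Real.sqrt (S.g (p.γ t) (p.v t) (p.v t))

/-- Sub-Riemannian distance. -/
def dSR {N : ℕ} (S : SRData N) (x y : EucSp N) : ℝ :=
  sInf {r | ∃ p : AdmPath S x y, r = p.length}

/-- Cameron–Martin space realized as `L²((0,1], ℝ^d)` via `h ↦ h'`. -/
abbrev CM (d : ℕ) := Lp (α := ℝ) (EucSp d) 2 μ01

/-! ### Part 1: measure-theoretic tools -/

/-- Change of variables along a strictly increasing absolutely continuous function. -/
theorem exists_reparam (w : ℝ → ℝ) (c : ℝ) (hc : 0 < c) (hcw : ∀ t, c ≤ w t)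
    (hw : LocallyIntegrable w volume) :
    ∃ σ : ℝ ≃o ℝ, σ 0 = 0 ∧ (∀ t, 0 ≤ t → σ t = ∫ s in Ioc 0 t, w s) ∧
      Measure.map σ (volume.withDensity (fun x => ((w x).toNNReal : ENNReal))) = volume := by
  have hI : ∀ a b, IntervalIntegrable w volume a b := fun x y =>
    intervalIntegrable_iff.mpr <|
      (hw.integrableOn_isCompact isCompact_uIcc).mono_set uIoc_subset_uIcc
  have hlow : ∀ a b, a ≤ b → c * (b - a) ≤ ∫ s in a..b, w s := by
    intro a b hab
    have := intervalIntegral.integral_mono_on hab (intervalIntegrable_const (c := c)) (hI a b)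
      (fun x _ => hcw x)
    simpa [mul_comm] using this
  let f : ℝ → ℝ := fun t => ∫ s in (0:ℝ)..t, w s
  have hsub : ∀ a b, f b - f a = ∫ s in a..b, w s := fun a b =>
    intervalIntegral.integral_interval_sub_left (hI _ _) (hI _ _)
  have hmono : StrictMono f := by
    intro a b hab
    have h1 := hlow a b hab.le
    have h2 := hsub a b
    have : 0 < c * (b - a) := mul_pos hc (sub_pos.2 hab)
    linarith
  have hcont : Continuous f := intervalIntegral.continuous_primitive hI 0
  have f0 : f 0 = 0 := by simp [f]
  have htop : Filter.Tendsto f Filter.atTop Filter.atTop := by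
    refine Filter.tendsto_atTop_mono' _ ?_ (Filter.tendsto_id.const_mul_atTop hc)
    filter_upwards [Filter.eventually_ge_atTop 0] with t ht
    have := hlow 0 t ht
    simpa [f] using this
  have hbot : Filter.Tendsto f Filter.atBot Filter.atBot := by
    refine Filter.tendsto_atBot_mono' _ ?_ (Filter.tendsto_id.const_mul_atBot hc)
    filter_upwards [Filter.eventually_le_atBot 0] with t ht
    have h1 := hlow t 0 ht
    have h2 := hsub t 0
    simp only [id]
    nlinarith
  have hsurj : Function.Surjective f := hcont.surjective htop hbot
  let σ : ℝ ≃o ℝ := hmono.orderIsoOfSurjective f hsurj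
  have hσ : ∀ t, σ t = f t := fun t => rfl
  refine ⟨σ, f0, fun t ht => by rw [hσ, ← intervalIntegral.integral_of_le ht], ?_⟩
  symm
  refine Measure.ext_of_Ioc _ _ ?_
  intro a b hab
  obtain ⟨a', rfl⟩ := σ.surjective a
  obtain ⟨b', rfl⟩ := σ.surjective b
  have hab' : a' < b' := σ.lt_iff_lt.1 hab
  rw [Measure.map_apply (σ.continuous.measurable) measurableSet_Ioc]
  have hpre : σ ⁻¹' Ioc (σ a') (σ b') = Ioc a' b' := by
    ext x; simp
  rw [hpre, withDensity_apply _ measurableSet_Ioc, Real.volume_Ioc]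
  have : ∫⁻ x in Ioc a' b', ((w x).toNNReal : ENNReal) = ∫⁻ x in Ioc a' b', ENNReal.ofReal (w x) := rfl
  rw [this, ← ofReal_integral_eq_lintegral_ofReal]
  · rw [hσ, hσ, hsub, intervalIntegral.integral_of_le hab'.le]
  · exact (hI a' b').1
  · exact Filter.Eventually.of_forall (fun x => hc.le.trans (hcw x))

theorem reparam_integral {E : Type*} [NormedAddCommGroup E] [NormedSpace ℝ E]
    (w : ℝ → ℝ) (c : ℝ) (hc : 0 < c) (hcw : ∀ t, c ≤ w t)
    (hw : LocallyIntegrable w volume) (σ : ℝ ≃o ℝ) (h0 : σ 0 = 0)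
    (hmap : Measure.map σ (volume.withDensity (fun x => ((w x).toNNReal : ENNReal))) = volume)
    (g : ℝ → E) (T : ℝ) :
    (IntegrableOn (fun r => g (σ.symm r)) (Ioc 0 (σ T)) ↔
      IntegrableOn (fun s => w s • g s) (Ioc 0 T)) ∧
    ∫ r in Ioc 0 (σ T), g (σ.symm r) = ∫ s in Ioc 0 T, w s • g s := by
  have hemb : MeasurableEmbedding σ := σ.toHomeomorph.measurableEmbedding
  have hpre : σ ⁻¹' Ioc 0 (σ T) = Ioc 0 T := by
    ext x; rw [mem_preimage, mem_Ioc, mem_Ioc, σ.le_iff_le]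
    nth_rewrite 1 [← h0]
    rw [σ.lt_iff_lt]
  have hm : AEMeasurable (fun x => (w x).toNNReal) (volume.restrict (Ioc 0 T)) :=
    (hw.aestronglyMeasurable.aemeasurable.real_toNNReal).restrict
  have hs : ∀ s, (w s).toNNReal • g s = w s • g s := by
    intro s
    rw [NNReal.smul_def, Real.coe_toNNReal _ (hc.le.trans (hcw s))]
  constructor
  · nth_rewrite 1 [← hmap]
    rw [hemb.integrableOn_map_iff, hpre, IntegrableOn, restrict_withDensity measurableSet_Ioc,
      integrable_withDensity_iff_integrable_smul₀ hm]
    simp [hs, IntegrableOn]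
  · nth_rewrite 1 [← hmap]
    rw [hemb.setIntegral_map, hpre, setIntegral_withDensity_eq_setIntegral_smul₀ hm _ measurableSet_Ioc]
    simp [hs]

/-- Gronwall with an integrable kernel. -/
theorem gronwall_L1 (k f : ℝ → ℝ) (T ε : ℝ) (hT : 0 ≤ T) (hk0 : ∀ t, 0 ≤ k t)
    (hk : IntegrableOn k (Ioc 0 T)) (hε : 0 ≤ ε) (hf0 : ∀ t ∈ Icc 0 T, 0 ≤ f t)
    (hf : ContinuousOn f (Icc 0 T))
    (hle : ∀ t ∈ Icc 0 T, f t ≤ ε + ∫ s in Ioc 0 t, k s * f s) :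
    ∀ t ∈ Icc 0 T, f t ≤ 2 * ε * Real.exp (2 * ((∫ s in Ioc 0 T, k s) + T)) := by
  let w : ℝ → ℝ := fun t => (Ioc 0 T).indicator k t + 1
  have hkI : Integrable ((Ioc 0 T).indicator k) volume := (integrable_indicator_iff measurableSet_Ioc).2 hk
  have hw : LocallyIntegrable w volume := hkI.locallyIntegrable.add (locallyIntegrable_const 1)
  have hcw : ∀ t, 1 ≤ w t := by
    intro t
    have : 0 ≤ (Ioc 0 T).indicator k t := indicator_nonneg (fun x _ => hk0 x) t
    simp only [w]; linarith
  obtain ⟨σ, h0, hσ, hmap⟩ := exists_reparam w 1 one_pos hcw hw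
  have hexp : ∀ t, 0 ≤ t → IntegrableOn (fun s => w s * Real.exp (2 * σ s)) (Ioc 0 t) ∧
      ∫ s in Ioc 0 t, w s * Real.exp (2 * σ s) = (Real.exp (2 * σ t) - 1) / 2 := by
    intro t ht
    have h := reparam_integral w 1 one_pos hcw hw σ h0 hmap (fun s => Real.exp (2 * σ s)) t
    have hσt : 0 ≤ σ t := by rw [← h0]; exact σ.monotone ht
    simp only [OrderIso.apply_symm_apply, smul_eq_mul] at h
    refine ⟨h.1.1 ?_, ?_⟩
    · exact (Continuous.integrableOn_Ioc (by fun_prop))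
    · rw [← h.2, ← intervalIntegral.integral_of_le hσt,
        intervalIntegral.integral_comp_mul_left (fun x => Real.exp x) two_ne_zero]
      simp; ring
  obtain ⟨t₀, ht₀, hmax⟩ := isCompact_Icc.exists_isMaxOn (nonempty_Icc.2 hT)
    (f := fun t => f t * Real.exp (-2 * σ t))
    (hf.mul (Continuous.continuousOn (by have := σ.continuous; fun_prop)))
  set M := f t₀ * Real.exp (-2 * σ t₀) with hM
  have hMf : ∀ t ∈ Icc 0 T, f t ≤ M * Real.exp (2 * σ t) := by
    intro t ht
    have h1 : f t * Real.exp (-2 * σ t) ≤ M := hmax ht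
    have h2 : Real.exp (-2 * σ t) * Real.exp (2 * σ t) = 1 := by
      rw [← Real.exp_add]; simp
    calc f t = f t * Real.exp (-2 * σ t) * Real.exp (2 * σ t) := by rw [mul_assoc, h2, mul_one]
      _ ≤ _ := by gcongr
  have hM0 : 0 ≤ M := mul_nonneg (hf0 _ ht₀) (Real.exp_pos _).le
  have hsub : Ioc 0 t₀ ⊆ Ioc 0 T := Ioc_subset_Ioc_right ht₀.2
  have hint : ∫ s in Ioc 0 t₀, k s * f s ≤ M * ((Real.exp (2 * σ t₀) - 1) / 2) := by
    rw [← (hexp t₀ ht₀.1).2, ← integral_const_mul]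
    refine integral_mono_of_nonneg ?_ ((hexp t₀ ht₀.1).1.const_mul M) ?_
    · filter_upwards [ae_restrict_mem measurableSet_Ioc] with s hs
      exact mul_nonneg (hk0 s) (hf0 s ⟨hs.1.le, hs.2.trans ht₀.2⟩)
    · filter_upwards [ae_restrict_mem measurableSet_Ioc] with s hs
      have hws : k s ≤ w s := by simp [w, indicator_of_mem (hsub hs)]
      have h3 := hMf s ⟨hs.1.le, hs.2.trans ht₀.2⟩
      have h4 := hf0 s ⟨hs.1.le, hs.2.trans ht₀.2⟩
      have h5 := hk0 s
      have h5' : 0 ≤ w s := h5.trans hws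
      calc k s * f s ≤ w s * (M * Real.exp (2 * σ s)) := by gcongr
        _ = _ := by ring
  have h6 := hle t₀ ht₀
  have h7 : f t₀ = M * Real.exp (2 * σ t₀) := by
    rw [hM, mul_assoc, ← Real.exp_add]; simp
  have hσ0 : 0 ≤ σ t₀ := by rw [← h0]; exact σ.monotone ht₀.1
  have h8 : 1 ≤ Real.exp (2 * σ t₀) := Real.one_le_exp (by linarith)
  have hM2 : M ≤ 2 * ε := by nlinarith
  have hσT : σ T = (∫ s in Ioc 0 T, k s) + T := by
    rw [hσ T hT]
    have : ∫ s in Ioc 0 T, w s = ∫ s in Ioc 0 T, (k s + 1) := by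
      refine setIntegral_congr_fun measurableSet_Ioc ?_
      intro s hs
      simp [w, indicator_of_mem hs]
    rw [this, integral_add hk (integrableOn_const (by simp))]
    simp [hT]
  intro t ht
  refine (hMf t ht).trans ?_
  have : σ t ≤ σ T := σ.monotone ht.2
  rw [← hσT]
  gcongr

theorem ae_eq_of_primitive_eq {E : Type*} [NormedAddCommGroup E] [NormedSpace ℝ E] [CompleteSpace E]
    (v w : ℝ → E) (T : ℝ) (hv : IntegrableOn v (Ioc 0 T)) (hw : IntegrableOn w (Ioc 0 T))
    (h : ∀ t ∈ Icc (0:ℝ) T, ∫ s in Ioc 0 t, v s = ∫ s in Ioc 0 t, w s) :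
    ∀ᵐ t ∂(volume.restrict (Ioc 0 T)), v t = w t := by
  rcases lt_or_ge T 0 with hT | hT
  · simp [Ioc_eq_empty (not_lt.2 hT.le)]
  have hvi : IntervalIntegrable v volume 0 T := (intervalIntegrable_iff_integrableOn_Ioc_of_le hT).2 hv
  have hwi : IntervalIntegrable w volume 0 T := (intervalIntegrable_iff_integrableOn_Ioc_of_le hT).2 hw
  rw [ae_restrict_iff' measurableSet_Ioc]
  filter_upwards [hvi.ae_hasDerivAt_integral, hwi.ae_hasDerivAt_integral,
    (by simp [ae_iff, measure_singleton] : ∀ᵐ x : ℝ, x ≠ T)] with t h1 h2 h3 ht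
  have htT : t < T := lt_of_le_of_ne ht.2 h3
  rw [uIcc_of_le hT] at h1 h2
  have h1' := h1 ⟨ht.1.le, ht.2⟩ 0 ⟨le_rfl, hT⟩
  have h2' := h2 ⟨ht.1.le, ht.2⟩ 0 ⟨le_rfl, hT⟩
  have : (fun x => ∫ s in (0:ℝ)..x, v s) =ᶠ[nhds t] (fun x => ∫ s in (0:ℝ)..x, w s) := by
    filter_upwards [Ioo_mem_nhds ht.1 htT] with x hx
    rw [intervalIntegral.integral_of_le hx.1.le, intervalIntegral.integral_of_le hx.1.le]
    exact h x ⟨hx.1.le, hx.2.le⟩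
  exact h1'.unique (h2'.congr_of_eventuallyEq this)

/-! ### Part 2: controlled ODEs -/

/-- The controlled vector field. -/
def VF {d NP : ℕ} (A : Fin d → EucSp NP → EucSp NP) (c : EucSp d) (y : EucSp NP) : EucSp NP :=
  ∑ i, c i • A i y

theorem VF_norm_le {d NP : ℕ} (A : Fin d → EucSp NP → EucSp NP) (c : EucSp d) (y : EucSp NP)
    (C : ℝ) (hC : ∑ i, ‖A i y‖ ≤ C) : ‖VF A c y‖ ≤ C * ‖c‖ := by
  calc ‖VF A c y‖ ≤ ∑ i, ‖c i • A i y‖ := norm_sum_le _ _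
    _ ≤ ∑ i, ‖c‖ * ‖A i y‖ := by
        refine Finset.sum_le_sum fun i _ => ?_
        rw [norm_smul]
        gcongr
        exact PiLp.norm_apply_le c i
    _ = ‖c‖ * ∑ i, ‖A i y‖ := by rw [Finset.mul_sum]
    _ ≤ ‖c‖ * C := by gcongr
    _ = _ := mul_comm _ _

theorem VF_sub_norm_le {d NP : ℕ} (A : Fin d → EucSp NP → EucSp NP) (c : EucSp d) (y z : EucSp NP)
    (C : ℝ) (hC : ∑ i, ‖A i y - A i z‖ ≤ C) : ‖VF A c y - VF A c z‖ ≤ C * ‖c‖ := by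
  have : VF A c y - VF A c z = ∑ i, c i • (A i y - A i z) := by
    simp [VF, smul_sub]
  rw [this]
  calc ‖∑ i, c i • (A i y - A i z)‖ ≤ ∑ i, ‖c i • (A i y - A i z)‖ := norm_sum_le _ _
    _ ≤ ∑ i, ‖c‖ * ‖A i y - A i z‖ := by
        refine Finset.sum_le_sum fun i _ => ?_
        rw [norm_smul]
        gcongr
        exact PiLp.norm_apply_le c i
    _ = ‖c‖ * ∑ i, ‖A i y - A i z‖ := by rw [Finset.mul_sum]
    _ ≤ ‖c‖ * C := by gcongr
    _ = _ := mul_comm _ _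

theorem VF_smul {d NP : ℕ} (A : Fin d → EucSp NP → EucSp NP) (a : ℝ) (c : EucSp d) (y : EucSp NP) :
    VF A (a • c) y = a • VF A c y := by
  simp [VF, Finset.smul_sum, smul_smul]

theorem exists_lip_const {d NP : ℕ} (A : Fin d → EucSp NP → EucSp NP)
    (hA : ∀ i, ContDiff ℝ (⊤ : ℕ∞) (A i)) (R : ℝ) :
    ∃ C : ℝ, 0 ≤ C ∧ (∀ y, ‖y‖ ≤ R → ∑ i, ‖A i y‖ ≤ C) ∧
      (∀ y z, ‖y‖ ≤ R → ‖z‖ ≤ R → ∑ i, ‖A i y - A i z‖ ≤ C * ‖y - z‖) := by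
  have h1 : ∀ i, ∃ K, LipschitzOnWith K (A i) (Metric.closedBall 0 R) := fun i =>
    (hA i).contDiffOn.exists_lipschitzOnWith (by simp) (convex_closedBall _ _)
      (isCompact_closedBall _ _)
  choose K hK using h1
  have h2 : ∃ B, ∀ y ∈ Metric.closedBall (0 : EucSp NP) R, ‖∑ i, ‖A i y‖‖ ≤ B :=
    (isCompact_closedBall _ _).exists_bound_of_continuousOn (by
      refine Continuous.continuousOn ?_
      have := fun i => (hA i).continuous
      fun_prop)
  obtain ⟨B, hB⟩ := h2
  have hs : (0:ℝ) ≤ ∑ i, (K i : ℝ) := Finset.sum_nonneg fun i _ => (K i).2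
  refine ⟨|B| + ∑ i, (K i : ℝ), by positivity, ?_, ?_⟩
  · intro y hy
    have := hB y (by simpa using hy)
    have h3 := le_abs_self (∑ i, ‖A i y‖)
    have h4 := le_abs_self B
    rw [Real.norm_eq_abs] at this
    linarith
  · intro y z hy hz
    calc ∑ i, ‖A i y - A i z‖ ≤ ∑ i, (K i : ℝ) * ‖y - z‖ := by
          refine Finset.sum_le_sum fun i _ => ?_
          exact (hK i).norm_sub_le (by simpa using hy) (by simpa using hz)
      _ = (∑ i, (K i : ℝ)) * ‖y - z‖ := by rw [Finset.sum_mul]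
      _ ≤ _ := by gcongr; linarith [abs_nonneg B]

theorem VF_integrable {d NP : ℕ} (A : Fin d → EucSp NP → EucSp NP)
    (hA : ∀ i, ContDiff ℝ (⊤ : ℕ∞) (A i)) (f : ℝ → EucSp d) (φ : ℝ → EucSp NP) (T : ℝ)
    (hf : IntegrableOn f (Ioc 0 T)) (hφ : ContinuousOn φ (Ioo 0 T)) (R : ℝ)
    (hR : ∀ t ∈ Ioo 0 T, ‖φ t‖ ≤ R) :
    IntegrableOn (fun s => VF A (f s) (φ s)) (Ioc 0 T) := by
  obtain ⟨C, hC0, hC, -⟩ := exists_lip_const A hA R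
  rw [integrableOn_Ioc_iff_integrableOn_Ioo] at hf ⊢
  refine Integrable.mono' (g := fun s => C * ‖f s‖) (hf.norm.const_mul C) ?_ ?_
  · unfold VF
    refine Finset.aestronglyMeasurable_fun_sum _ fun i _ => ?_
    have m1 : AEStronglyMeasurable (fun s => f s i) (volume.restrict (Ioo 0 T)) :=
      (EuclideanSpace.proj (𝕜 := ℝ) i).continuous.comp_aestronglyMeasurable hf.1
    have m2 : AEStronglyMeasurable (fun s => A i (φ s)) (volume.restrict (Ioo 0 T)) :=
      ((hA i).continuous.comp_continuousOn hφ).aestronglyMeasurable measurableSet_Ioo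
    exact m1.smul m2
  · filter_upwards [ae_restrict_mem measurableSet_Ioo] with s hs
    exact VF_norm_le A _ _ C (hC _ (hR s hs))

/-- `φ` is a (continuous) solution on `[0,T]`. -/
def IsSol {d NP : ℕ} (A : Fin d → EucSp NP → EucSp NP) (u : EucSp NP) (f : ℝ → EucSp d)
    (φ : ℝ → EucSp NP) (T : ℝ) : Prop :=
  ContinuousOn φ (Icc 0 T) ∧ ∀ t ∈ Icc 0 T, φ t = u + ∫ s in Ioc 0 t, VF A (f s) (φ s)

theorem ContinuousOn.exists_norm_le_Icc {NP : ℕ} {φ : ℝ → EucSp NP} {T : ℝ}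
    (h : ContinuousOn φ (Icc 0 T)) : ∃ R, ∀ t ∈ Icc 0 T, ‖φ t‖ ≤ R :=
  isCompact_Icc.exists_bound_of_continuousOn h

theorem IsSol.integrableOn {d NP : ℕ} {A : Fin d → EucSp NP → EucSp NP} {u : EucSp NP}
    {f : ℝ → EucSp d} {φ : ℝ → EucSp NP} {T : ℝ} (h : IsSol A u f φ T)
    (hA : ∀ i, ContDiff ℝ (⊤ : ℕ∞) (A i)) (hf : IntegrableOn f (Ioc 0 T)) :
    IntegrableOn (fun s => VF A (f s) (φ s)) (Ioc 0 T) := by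
  obtain ⟨R, hR⟩ := h.1.exists_norm_le_Icc
  exact VF_integrable A hA f φ T hf (h.1.mono Ioo_subset_Icc_self) R
    (fun t ht => hR t (Ioo_subset_Icc_self ht))

theorem IsSol.mono {d NP : ℕ} {A : Fin d → EucSp NP → EucSp NP} {u : EucSp NP}
    {f : ℝ → EucSp d} {φ : ℝ → EucSp NP} {T T' : ℝ} (h : IsSol A u f φ T) (hT : T' ≤ T) :
    IsSol A u f φ T' :=
  ⟨h.1.mono (Icc_subset_Icc_right hT), fun t ht => h.2 t ⟨ht.1, ht.2.trans hT⟩⟩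

theorem IsSol.congr_ae {d NP : ℕ} {A : Fin d → EucSp NP → EucSp NP} {u : EucSp NP}
    {f f' : ℝ → EucSp d} {φ : ℝ → EucSp NP} {T : ℝ} (h : IsSol A u f φ T)
    (hff : ∀ᵐ s ∂(volume.restrict (Ioc 0 T)), f s = f' s) : IsSol A u f' φ T := by
  refine ⟨h.1, fun t ht => ?_⟩
  rw [h.2 t ht]
  congr 1
  refine integral_congr_ae ?_
  have := ae_restrict_of_ae_restrict_of_subset (Ioc_subset_Ioc_right ht.2) hff
  filter_upwards [this] with s hs
  rw [hs]

/-- A function with an integral representation is continuous. -/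
theorem continuousOn_of_rep {NP : ℕ} {φ F : ℝ → EucSp NP} {u : EucSp NP} {T : ℝ}
    (hF : IntegrableOn F (Ioc 0 T)) (h : ∀ t ∈ Icc 0 T, φ t = u + ∫ s in Ioc 0 t, F s) :
    ContinuousOn φ (Icc 0 T) := by
  have : ContinuousOn (fun t => u + ∫ s in Ioc 0 t, F s) (Icc 0 T) :=
    continuousOn_const.add (intervalIntegral.continuousOn_primitive
      ((integrableOn_Icc_iff_integrableOn_Ioc).2 hF))
  exact this.congr h

theorem exists_first (f : ℝ → ℝ) (T : ℝ) (hf : ContinuousOn f (Icc 0 T)) (h0 : f 0 < 1)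
    (t : ℝ) (ht : t ∈ Icc 0 T) (h1 : 1 ≤ f t) :
    ∃ τ ∈ Icc 0 T, f τ = 1 ∧ ∀ s ∈ Icc 0 τ, f s ≤ 1 := by
  have hcl : IsCompact (Icc 0 T ∩ f ⁻¹' (Ici 1)) :=
    isCompact_Icc.of_isClosed_subset (hf.preimage_isClosed_of_isClosed isClosed_Icc isClosed_Ici)
      inter_subset_left
  obtain ⟨τ, ⟨hτ, hτ1⟩, hmin⟩ := hcl.exists_isLeast ⟨t, ht, h1⟩
  have hlt : ∀ s ∈ Icc 0 T, s < τ → f s < 1 := by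
    intro s hs hsτ
    by_contra hcon
    exact absurd (hmin ⟨hs, not_lt.1 hcon⟩) (not_le.2 hsτ)
  have hτ1' : 1 ≤ f τ := hτ1
  have hτ0 : 0 < τ := by
    rcases hτ.1.eq_or_lt with h | h
    · rw [← h] at hτ1'; linarith
    · exact h
  have hle : f τ ≤ 1 := by
    have hc : ContinuousWithinAt f (Ico 0 τ) τ := (hf τ hτ).mono
      (fun s hs => ⟨hs.1, hs.2.le.trans hτ.2⟩)
    have hmem : τ ∈ closure (Ico 0 τ) := by
      rw [closure_Ico hτ0.ne]; exact ⟨hτ0.le, le_rfl⟩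
    have := hc.mem_closure_image hmem
    have hsub : f '' (Ico 0 τ) ⊆ Iic 1 := by
      rintro _ ⟨s, hs, rfl⟩
      exact (hlt s ⟨hs.1, hs.2.le.trans hτ.2⟩ hs.2).le
    exact (closure_minimal hsub isClosed_Iic) this
  refine ⟨τ, hτ, le_antisymm hle hτ1', fun s hs => ?_⟩
  rcases hs.2.eq_or_lt with h | h
  · rw [h]; exact hle
  · exact (hlt s ⟨hs.1, hs.2.trans hτ.2⟩ h).le

/-- Quantitative stability, with the exit-time argument built in. -/
theorem stability {d NP : ℕ} {A : Fin d → EucSp NP → EucSp NP} {u : EucSp NP}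
    (hA : ∀ i, ContDiff ℝ (⊤ : ℕ∞) (A i))
    {f g : ℝ → EucSp d} {φ ψ : ℝ → EucSp NP} {T : ℝ} (hT : 0 ≤ T)
    (hf : IntegrableOn f (Ioc 0 T)) (hg : IntegrableOn g (Ioc 0 T))
    (hφ : IsSol A u f φ T) (hψ : IsSol A u g ψ T) (R C ε : ℝ) (hC0 : 0 ≤ C)
    (hR : ∀ t ∈ Icc 0 T, ‖ψ t‖ ≤ R)
    (hC : ∀ y z, ‖y‖ ≤ R + 1 → ‖z‖ ≤ R + 1 → ∑ i, ‖A i y - A i z‖ ≤ C * ‖y - z‖)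
    (hε : ∀ t ∈ Icc 0 T, ‖∫ s in Ioc 0 t, (VF A (f s) (ψ s) - VF A (g s) (ψ s))‖ ≤ ε)
    (hsmall : 2 * ε * Real.exp (2 * (C * (∫ s in Ioc 0 T, ‖f s‖) + T)) < 1) :
    ∀ t ∈ Icc 0 T, ‖φ t - ψ t‖ ≤ 2 * ε * Real.exp (2 * (C * (∫ s in Ioc 0 T, ‖f s‖) + T)) := by
  have hε0 : 0 ≤ ε := (norm_nonneg _).trans (hε 0 ⟨le_rfl, hT⟩)
  have hcont : ContinuousOn (fun t => ‖φ t - ψ t‖) (Icc 0 T) := (hφ.1.sub hψ.1).norm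
  have hIφ := hφ.integrableOn hA hf
  have hIψ := hψ.integrableOn hA hg
  obtain ⟨R', hR'⟩ := hψ.1.exists_norm_le_Icc
  have hIm : IntegrableOn (fun s => VF A (f s) (ψ s)) (Ioc 0 T) :=
    VF_integrable A hA f ψ T hf (hψ.1.mono Ioo_subset_Icc_self) R'
      (fun t ht => hR' t (Ioo_subset_Icc_self ht))
  have key : ∀ τ ∈ Icc 0 T, (∀ s ∈ Icc 0 τ, ‖φ s - ψ s‖ ≤ 1) →
      ‖φ τ - ψ τ‖ ≤ 2 * ε * Real.exp (2 * (C * (∫ s in Ioc 0 T, ‖f s‖) + T)) := by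
    intro τ hτ hle1
    have hsubτ : Ioc 0 τ ⊆ Ioc 0 T := Ioc_subset_Ioc_right hτ.2
    have hgr := gronwall_L1 (fun s => C * ‖f s‖) (fun t => ‖φ t - ψ t‖) τ ε hτ.1
      (fun t => by positivity) ((hf.mono_set hsubτ).norm.const_mul C) hε0
      (fun t _ => norm_nonneg _) (hcont.mono (Icc_subset_Icc_right hτ.2)) ?_ τ ⟨hτ.1, le_rfl⟩
    · refine hgr.trans ?_
      rw [integral_const_mul]
      have : ∫ s in Ioc 0 τ, ‖f s‖ ≤ ∫ s in Ioc 0 T, ‖f s‖ :=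
        setIntegral_mono_set hf.norm (Filter.Eventually.of_forall fun _ => norm_nonneg _)
          hsubτ.eventuallyLE
      have := hτ.2
      gcongr
    · intro t ht
      have htT : t ∈ Icc 0 T := ⟨ht.1, ht.2.trans hτ.2⟩
      have hsub : Ioc 0 t ⊆ Ioc 0 T := Ioc_subset_Ioc_right htT.2
      have heq : φ t - ψ t = (∫ s in Ioc 0 t, (VF A (f s) (φ s) - VF A (f s) (ψ s))) +
          ∫ s in Ioc 0 t, (VF A (f s) (ψ s) - VF A (g s) (ψ s)) := by
        rw [integral_sub (hIφ.mono_set hsub) (hIm.mono_set hsub),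
          integral_sub (hIm.mono_set hsub) (hIψ.mono_set hsub), hφ.2 t htT, hψ.2 t htT]
        abel
      show ‖φ t - ψ t‖ ≤ _
      rw [heq]
      refine (norm_add_le _ _).trans ?_
      rw [add_comm]
      refine add_le_add (hε t htT) ?_
      refine norm_integral_le_of_norm_le ?_ ?_
      · have hb : IntegrableOn (fun s => ‖f s‖ * ‖φ s - ψ s‖) (Ioc 0 t) := by
          obtain ⟨B, hB⟩ := (hφ.1.sub hψ.1).exists_norm_le_Icc
          refine Integrable.mul_bdd (c := B) (hf.mono_set hsub).norm ?_ ?_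
          · exact (hcont.mono (hsub.trans Ioc_subset_Icc_self)).aestronglyMeasurable measurableSet_Ioc
          · filter_upwards [ae_restrict_mem measurableSet_Ioc] with s hs
            rw [norm_norm]
            exact hB s (Ioc_subset_Icc_self (hsub hs))
        have := hb.const_mul C
        simpa [mul_assoc] using this
      · filter_upwards [ae_restrict_mem measurableSet_Ioc] with s hs
        have hsT : s ∈ Icc 0 T := Ioc_subset_Icc_self (hsub hs)
        have h1 : ‖ψ s‖ ≤ R := hR s hsT
        have h2 : ‖φ s - ψ s‖ ≤ 1 := hle1 s ⟨hs.1.le, hs.2.trans ht.2⟩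
        have h3 : ‖φ s‖ ≤ R + 1 := by
          have := norm_add_le (φ s - ψ s) (ψ s)
          rw [sub_add_cancel] at this
          linarith
        refine (VF_sub_norm_le A _ _ _ _ (hC _ _ h3 (by linarith))).trans (le_of_eq ?_)
        ring
  intro t ht
  refine key t ht ?_
  by_contra hcon
  push Not at hcon
  obtain ⟨s, hs, hs1⟩ := hcon
  have h00 : ‖φ 0 - ψ 0‖ < 1 := by
    rw [hφ.2 0 ⟨le_rfl, hT⟩, hψ.2 0 ⟨le_rfl, hT⟩]; simp
  obtain ⟨τ, hτ, hτ1, hτle⟩ := exists_first _ T hcont h00 s ⟨hs.1, hs.2.trans ht.2⟩ hs1.le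
  have := key τ hτ hτle
  linarith

theorem IsSol.unique {d NP : ℕ} {A : Fin d → EucSp NP → EucSp NP} {u : EucSp NP}
    (hA : ∀ i, ContDiff ℝ (⊤ : ℕ∞) (A i))
    {f g : ℝ → EucSp d} {φ ψ : ℝ → EucSp NP} {T : ℝ}
    (hf : IntegrableOn f (Ioc 0 T))
    (hφ : IsSol A u f φ T) (hψ : IsSol A u g ψ T)
    (hfg : ∀ᵐ s ∂(volume.restrict (Ioc 0 T)), f s = g s) :
    ∀ t ∈ Icc 0 T, φ t = ψ t := by
  intro t ht
  have hT : 0 ≤ T := ht.1.trans ht.2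
  obtain ⟨R, hR⟩ := hψ.1.exists_norm_le_Icc
  obtain ⟨C, hC0, -, hC⟩ := exists_lip_const A hA (R + 1)
  have hψ' : IsSol A u f ψ T := hψ.congr_ae (hfg.mono fun _ h => h.symm)
  have := stability hA hT hf hf hφ hψ' R C 0 hC0 hR hC (by simp) (by simp) t ht
  simp only [mul_zero, zero_mul, norm_le_zero_iff] at this
  exact sub_eq_zero.1 this

/-! ### Part 3: the Cameron-Martin space -/

instance : IsFiniteMeasure μ01 := by unfold μ01; infer_instance

theorem CM_integrable {d : ℕ} (h : CM d) : IntegrableOn h (Ioc (0:ℝ) 1) :=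
  (Lp.memLp h).integrable one_le_two

theorem CM_integrable_sq {d : ℕ} (h : CM d) : IntegrableOn (fun s => ‖h s‖ ^ 2) (Ioc (0:ℝ) 1) :=
  (Lp.memLp h).integrable_norm_pow two_ne_zero

theorem CM_norm_sq {d : ℕ} (h : CM d) : ‖h‖ ^ 2 = ∫ s in Ioc (0:ℝ) 1, ‖h s‖ ^ 2 := by
  rw [← real_inner_self_eq_norm_sq, L2.inner_def]
  simp only [real_inner_self_eq_norm_sq]
  rfl

theorem CM_integral_le {d : ℕ} (h : CM d) (s t a : ℝ) (hs : 0 ≤ s) (hst : s ≤ t) (ht : t ≤ 1)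
    (ha : 0 < a) : ∫ r in Ioc s t, ‖h r‖ ≤ (a * (t - s) + ‖h‖ ^ 2 / a) / 2 := by
  have hsub : Ioc s t ⊆ Ioc 0 1 := Ioc_subset_Ioc hs ht
  have h1 : ∫ r in Ioc s t, ‖h r‖ ≤ ∫ r in Ioc s t, (a / 2 + ‖h r‖ ^ 2 * (1 / (2 * a))) := by
    refine setIntegral_mono_on ((CM_integrable h).mono_set hsub).norm ?_ measurableSet_Ioc ?_
    · exact (integrableOn_const (by simp)).add (((CM_integrable_sq h).mono_set hsub).mul_const _)
    · intro r _
      have : a / 2 + ‖h r‖ ^ 2 * (1 / (2 * a)) - ‖h r‖ = (‖h r‖ - a) ^ 2 / (2 * a) := by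
        field_simp; ring
      have h2 : 0 ≤ (‖h r‖ - a) ^ 2 / (2 * a) := by positivity
      linarith
  have h3 : ∫ r in Ioc s t, ‖h r‖ ^ 2 ≤ ‖h‖ ^ 2 := by
    rw [CM_norm_sq]
    exact setIntegral_mono_set (CM_integrable_sq h)
      (Filter.Eventually.of_forall fun _ => by positivity) hsub.eventuallyLE
  refine h1.trans ?_
  have hi1 : Integrable (fun _ : ℝ => a / 2) (volume.restrict (Ioc s t)) :=
    integrableOn_const (by simp)
  rw [integral_add hi1 (((CM_integrable_sq h).mono_set hsub).mul_const _), integral_mul_const]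
  have h4 : ∫ r in Ioc s t, a / 2 = (t - s) * (a / 2) := by simp [hst]
  rw [h4]
  have h5 : (∫ r in Ioc s t, ‖h r‖ ^ 2) * (1 / (2 * a)) ≤ ‖h‖ ^ 2 * (1 / (2 * a)) := by gcongr
  have h6 : ‖h‖ ^ 2 * (1 / (2 * a)) = ‖h‖ ^ 2 / a / 2 := by field_simp
  linarith

theorem CM_L1_le {d : ℕ} (h : CM d) : ∫ r in Ioc (0:ℝ) 1, ‖h r‖ ≤ ‖h‖ := by
  refine le_of_forall_pos_le_add fun δ hδ => ?_
  have h0 := norm_nonneg h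
  have h1 := CM_integral_le h 0 1 (‖h‖ + δ) le_rfl zero_le_one le_rfl (by positivity)
  have h2 : ‖h‖ ^ 2 / (‖h‖ + δ) ≤ ‖h‖ := by
    rw [div_le_iff₀ (by positivity)]; nlinarith
  linarith

theorem CM_L1_le_of_le {d : ℕ} (h : CM d) (t : ℝ) (ht1 : t ≤ 1) :
    ∫ r in Ioc (0:ℝ) t, ‖h r‖ ≤ ‖h‖ :=
  (setIntegral_mono_set (CM_integrable h).norm
      (Filter.Eventually.of_forall fun _ => norm_nonneg _)
      (Ioc_subset_Ioc_right ht1).eventuallyLE).trans (CM_L1_le h)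

/-- Truncation of a control. -/
theorem CM_trunc {d : ℕ} (h : CM d) (s : ℝ) (hs1 : s ≤ 1) :
    ∃ k : CM d, (∀ᵐ t ∂(volume.restrict (Ioc (0:ℝ) 1)), (Ioc 0 s).indicator h t = k t) ∧
      ‖k‖ ^ 2 = ∫ t in Ioc 0 s, ‖h t‖ ^ 2 := by
  have hm : MemLp ((Ioc 0 s).indicator h) 2 μ01 := (Lp.memLp h).indicator measurableSet_Ioc
  have hae : ∀ᵐ t ∂(volume.restrict (Ioc (0:ℝ) 1)), (Ioc 0 s).indicator h t = hm.toLp _ t :=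
    hm.coeFn_toLp.symm
  refine ⟨hm.toLp _, hae, ?_⟩
  rw [CM_norm_sq]
  have : ∫ t in Ioc (0:ℝ) 1, ‖hm.toLp _ t‖ ^ 2 =
      ∫ t in Ioc (0:ℝ) 1, (Ioc 0 s).indicator (fun t => ‖h t‖ ^ 2) t := by
    refine integral_congr_ae ?_
    filter_upwards [hae] with t ht
    rw [← ht]
    by_cases hts : t ∈ Ioc 0 s <;> simp [hts]
  rw [this, setIntegral_indicator measurableSet_Ioc,
    inter_eq_self_of_subset_right (Ioc_subset_Ioc_right hs1)]

/-- Reparametrization of a control. -/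
theorem CM_reparam {d : ℕ} (h : CM d) (w : ℝ → ℝ) (c : ℝ) (hc : 0 < c) (hcw : ∀ t, c ≤ w t)
    (hwm : Measurable w)
    (hw : LocallyIntegrable w volume) (σ : ℝ ≃o ℝ) (h0 : σ 0 = 0) (h1 : σ 1 ≤ 1)
    (hmap : Measure.map σ (volume.withDensity (fun x => ((w x).toNNReal : ENNReal))) = volume) :
    ∃ H : CM d, (∀ᵐ r ∂(volume.restrict (Ioc 0 (σ 1))),
        (w (σ.symm r))⁻¹ • h (σ.symm r) = H r) ∧
      ‖H‖ ^ 2 = ∫ s in Ioc (0:ℝ) 1, (w s)⁻¹ * ‖h s‖ ^ 2 := by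
  have hσ1 : 0 < σ 1 := by rw [← h0]; exact σ.strictMono one_pos
  have hsub : Ioc 0 (σ 1) ⊆ Ioc 0 1 := Ioc_subset_Ioc_right h1
  have hcomp : ∀ s, w s * ((w s)⁻¹ * ‖h s‖) ^ 2 = (w s)⁻¹ * ‖h s‖ ^ 2 := by
    intro s
    have : w s ≠ 0 := (hc.trans_le (hcw s)).ne'
    field_simp
  have hri := reparam_integral w c hc hcw hw σ h0 hmap (fun s => ((w s)⁻¹ * ‖h s‖) ^ 2) 1
  simp only [smul_eq_mul, hcomp] at hri
  have hI : IntegrableOn (fun s => (w s)⁻¹ * ‖h s‖ ^ 2) (Ioc (0:ℝ) 1) := by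
    refine Integrable.bdd_mul (c := c⁻¹) (CM_integrable_sq h)
      hwm.inv.aestronglyMeasurable ?_
    refine Filter.Eventually.of_forall fun s => ?_
    rw [norm_inv, Real.norm_of_nonneg (hc.le.trans (hcw s))]
    gcongr
    exact hcw s
  let F : ℝ → EucSp d := fun r => (w (σ.symm r))⁻¹ • h (σ.symm r)
  have hFm : StronglyMeasurable F := by
    have m1 : Measurable (fun r => (w (σ.symm r))⁻¹) :=
      (hwm.comp σ.symm.continuous.measurable).inv
    have m2 : StronglyMeasurable (fun r => h (σ.symm r)) :=
      (Lp.stronglyMeasurable h).comp_measurable σ.symm.continuous.measurable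
    exact m1.stronglyMeasurable.smul m2
  have hFn : ∀ r, ‖F r‖ ^ 2 = ((w (σ.symm r))⁻¹ * ‖h (σ.symm r)‖) ^ 2 := by
    intro r
    simp only [F]
    rw [norm_smul, norm_inv, Real.norm_of_nonneg (hc.le.trans (hcw _))]
  have hm : MemLp ((Ioc 0 (σ 1)).indicator F) 2 μ01 := by
    have e : μ01.restrict (Ioc 0 (σ 1)) = volume.restrict (Ioc 0 (σ 1)) := by
      unfold μ01
      rw [Measure.restrict_restrict measurableSet_Ioc, inter_eq_self_of_subset_left hsub]
    rw [memLp_indicator_iff_restrict measurableSet_Ioc, e,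
      memLp_two_iff_integrable_sq_norm hFm.aestronglyMeasurable]
    simp only [hFn]
    exact hri.1.2 hI
  have hae : ∀ᵐ t ∂(volume.restrict (Ioc (0:ℝ) 1)),
      (Ioc 0 (σ 1)).indicator F t = hm.toLp _ t := hm.coeFn_toLp.symm
  refine ⟨hm.toLp _, ?_, ?_⟩
  · filter_upwards [ae_restrict_of_ae_restrict_of_subset hsub hae,
      ae_restrict_mem measurableSet_Ioc] with r hr hr'
    rw [← hr, indicator_of_mem hr']
  · rw [CM_norm_sq]
    have : ∫ t in Ioc (0:ℝ) 1, ‖hm.toLp _ t‖ ^ 2 =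
        ∫ t in Ioc (0:ℝ) 1, (Ioc 0 (σ 1)).indicator (fun t => ‖F t‖ ^ 2) t := by
      refine integral_congr_ae ?_
      filter_upwards [hae] with t ht
      rw [← ht]
      by_cases hts : t ∈ Ioc 0 (σ 1) <;> simp [hts]
    rw [this, setIntegral_indicator measurableSet_Ioc, inter_eq_self_of_subset_right hsub]
    simp only [hFn]
    exact hri.2

theorem IsSol.reparam {d NP : ℕ} {A : Fin d → EucSp NP → EucSp NP} {u : EucSp NP}
    {f : ℝ → EucSp d} {φ : ℝ → EucSp NP} {T : ℝ} (h : IsSol A u f φ T)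
    (w : ℝ → ℝ) (c : ℝ) (hc : 0 < c) (hcw : ∀ t, c ≤ w t)
    (hw : LocallyIntegrable w volume) (σ : ℝ ≃o ℝ) (h0 : σ 0 = 0)
    (hmap : Measure.map σ (volume.withDensity (fun x => ((w x).toNNReal : ENNReal))) = volume) :
    IsSol A u (fun r => (w (σ.symm r))⁻¹ • f (σ.symm r)) (fun r => φ (σ.symm r)) (σ T) := by
  have hmt : ∀ r ∈ Icc 0 (σ T), σ.symm r ∈ Icc 0 T := by
    intro r hr
    constructor
    · rw [OrderIso.le_symm_apply, h0]; exact hr.1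
    · rw [OrderIso.symm_apply_le]; exact hr.2
  refine ⟨h.1.comp σ.symm.continuous.continuousOn hmt, fun r hr => ?_⟩
  have h2 := h.2 _ (hmt r hr)
  show φ (σ.symm r) = _
  rw [h2]
  congr 1
  have h3 := (reparam_integral w c hc hcw hw σ h0 hmap
    (fun s => (w s)⁻¹ • VF A (f s) (φ s)) (σ.symm r)).2
  rw [OrderIso.apply_symm_apply] at h3
  simp only [VF_smul]
  rw [h3]
  refine integral_congr_ae (Filter.Eventually.of_forall fun s => ?_)
  have : w s ≠ 0 := (hc.trans_le (hcw s)).ne'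
  simp [smul_smul, this]

/-- Truncated solutions. -/
theorem IsSol.trunc {d NP : ℕ} {A : Fin d → EucSp NP → EucSp NP} {u : EucSp NP}
    {f : ℝ → EucSp d} {φ : ℝ → EucSp NP} (h : IsSol A u f φ 1) (s : ℝ) (hs0 : 0 ≤ s) :
    IsSol A u ((Ioc 0 s).indicator f) (fun t => φ (min t s)) 1 := by
  have hmt : ∀ t ∈ Icc (0:ℝ) 1, min t s ∈ Icc (0:ℝ) 1 := fun t ht =>
    ⟨le_min ht.1 hs0, (min_le_left _ _).trans ht.2⟩
  refine ⟨h.1.comp (by fun_prop) hmt, fun t ht => ?_⟩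
  show φ (min t s) = _
  rw [h.2 _ (hmt t ht)]
  congr 1
  have : ∀ r, VF A ((Ioc 0 s).indicator f r) (φ (min r s)) =
      (Ioc 0 s).indicator (fun r => VF A (f r) (φ r)) r := by
    intro r
    by_cases hr : r ∈ Ioc 0 s
    · simp [hr, min_eq_left hr.2]
    · simp [hr, VF]
  simp only [this]
  rw [setIntegral_indicator measurableSet_Ioc, Ioc_inter_Ioc, max_self]

/-- Weak sequential compactness along ultrafilters. -/
theorem weak_limit {E : Type*} [NormedAddCommGroup E] [InnerProductSpace ℝ E] [CompleteSpace E]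
    (x : ℕ → E) (R : ℝ) (hx : ∀ n, ‖x n‖ ≤ R) (U : Ultrafilter ℕ) :
    ∃ y : E, ∀ l : E →L[ℝ] ℝ, Filter.Tendsto (fun n => l (x n)) U (nhds (l y)) := by
  let F : ℕ → WeakDual ℝ E := fun n => StrongDual.toWeakDual (InnerProductSpace.toDual ℝ E (x n))
  have hc := WeakDual.isCompact_closedBall (𝕜 := ℝ) (E := E) 0 R
  have hF : ∀ n, F n ∈ WeakDual.toStrongDual ⁻¹' Metric.closedBall (0 : StrongDual ℝ E) R := by
    intro n
    simp only [mem_preimage, mem_closedBall_zero_iff, F]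
    exact ((InnerProductSpace.toDual ℝ E).norm_map (x n)).le.trans (hx n)
  obtain ⟨f, -, hf⟩ := hc.ultrafilter_le_nhds' (U.map F)
    (by
      rw [Ultrafilter.mem_map]
      exact Filter.univ_mem' hF)
  let y : E := (InnerProductSpace.toDual ℝ E).symm (WeakDual.toStrongDual f)
  have hfy : ∀ z, f z = inner ℝ y z := by
    intro z
    simp only [y]
    rw [InnerProductSpace.toDual_symm_apply]
    rfl
  have hz : ∀ z, Filter.Tendsto (fun n => inner ℝ (x n) z) U (nhds (inner ℝ y z)) := by
    intro z
    have h1 : Filter.Tendsto F U (nhds f) := hf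
    have h2 := ((WeakDual.eval_continuous (𝕜 := ℝ) z).tendsto f).comp h1
    rw [← hfy]
    exact h2
  refine ⟨y, fun l => ?_⟩
  have hl : ∀ z, l z = inner ℝ z ((InnerProductSpace.toDual ℝ E).symm l) := by
    intro z
    rw [real_inner_comm, InnerProductSpace.toDual_symm_apply]
  simp only [hl]
  exact hz _

/-! ### Part 4: no explosion -/

theorem Phi_isSol_of_int {NP d : ℕ} {A : Fin d → EucSp NP → EucSp NP} {u : EucSp NP}
    {h : ℝ → EucSp d} {φ : ℝ → EucSp NP}
    (hφ : ∀ t ∈ Icc (0:ℝ) 1, φ t = u + ∫ s in Ioc (0:ℝ) t, VF A (h s) (φ s))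
    (t : ℝ) (ht : t ≤ 1) (hG : IntegrableOn (fun s => VF A (h s) (φ s)) (Ioc 0 t)) :
    IsSol A u h φ t :=
  ⟨continuousOn_of_rep hG (fun r hr => hφ r ⟨hr.1, hr.2.trans ht⟩),
    fun r hr => hφ r ⟨hr.1, hr.2.trans ht⟩⟩

theorem ext_int {NP d : ℕ} {A : Fin d → EucSp NP → EucSp NP} {u : EucSp NP}
    (hA : ∀ i, ContDiff ℝ (⊤ : ℕ∞) (A i))
    {h : ℝ → EucSp d} {φ : ℝ → EucSp NP} (hh : IntegrableOn h (Ioc 0 1))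
    (hφ : ∀ t ∈ Icc (0:ℝ) 1, φ t = u + ∫ s in Ioc (0:ℝ) t, VF A (h s) (φ s))
    (t : ℝ) (ht : t ≤ 1)
    (hG : ∀ s, 0 ≤ s → s < t → IntegrableOn (fun s => VF A (h s) (φ s)) (Ioc 0 s))
    (R : ℝ) (hR : ∀ s ∈ Ioo 0 t, ‖φ s‖ ≤ R) :
    IntegrableOn (fun s => VF A (h s) (φ s)) (Ioc 0 t) := by
  refine VF_integrable A hA h φ t (hh.mono_set (Ioc_subset_Ioc_right ht)) ?_ R hR
  intro x hx
  obtain ⟨s, hxs, hst⟩ := exists_between hx.2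
  have hs0 : 0 ≤ s := hx.1.le.trans hxs.le
  have hsol := Phi_isSol_of_int hφ s (hst.le.trans ht) (hG s hs0 hst)
  exact (hsol.1.continuousAt (Icc_mem_nhds hx.1 hxs)).continuousWithinAt

theorem blowup {NP d : ℕ} {A : Fin d → EucSp NP → EucSp NP} {u : EucSp NP}
    (hA : ∀ i, ContDiff ℝ (⊤ : ℕ∞) (A i))
    {h : ℝ → EucSp d} {φ : ℝ → EucSp NP} (hh : IntegrableOn h (Ioc 0 1))
    (hφ : ∀ t ∈ Icc (0:ℝ) 1, φ t = u + ∫ s in Ioc (0:ℝ) t, VF A (h s) (φ s))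
    (hn : ¬ IntegrableOn (fun s => VF A (h s) (φ s)) (Ioc 0 1)) :
    ∃ τ, 0 < τ ∧ τ ≤ 1 ∧
      (∀ s, 0 ≤ s → s < τ → IntegrableOn (fun s => VF A (h s) (φ s)) (Ioc 0 s)) ∧
      (¬ IntegrableOn (fun s => VF A (h s) (φ s)) (Ioc 0 τ)) ∧
      ∀ t ∈ Icc τ 1, φ t = u := by
  let G : ℝ → Prop := fun t => IntegrableOn (fun s => VF A (h s) (φ s)) (Ioc 0 t)
  have Gmono : ∀ s t, s ≤ t → G t → G s := fun s t hst ht =>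
    IntegrableOn.mono_set ht (Ioc_subset_Ioc_right hst)
  have Gu : ∀ t ∈ Icc (0:ℝ) 1, ¬ G t → φ t = u := by
    intro t ht hGt
    rw [hφ t ht, integral_undef hGt, add_zero]
  let S : Set ℝ := {t | t ∈ Icc (0:ℝ) 1 ∧ G t}
  have hS0 : (0:ℝ) ∈ S := ⟨⟨le_rfl, zero_le_one⟩, by simp [G]⟩
  have hSb : BddAbove S := ⟨1, fun t ht => ht.1.2⟩
  set τ := sSup S with hτ
  have hτ0 : 0 ≤ τ := le_csSup hSb hS0
  have hτ1 : τ ≤ 1 := csSup_le ⟨0, hS0⟩ (fun t ht => ht.1.2)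
  have hlt : ∀ s, s < τ → G s := by
    intro s hs
    obtain ⟨t, ht, hst⟩ := exists_lt_of_lt_csSup ⟨0, hS0⟩ hs
    exact Gmono s t hst.le ht.2
  have hGτ : ¬ G τ := by
    intro hGτ
    apply hn
    have hgt : ∀ t ∈ Ioc τ 1, φ t = u := by
      intro t ht
      refine Gu t ⟨hτ0.trans ht.1.le, ht.2⟩ fun hG => ?_
      exact absurd (le_csSup hSb ⟨⟨hτ0.trans ht.1.le, ht.2⟩, hG⟩) (not_le.2 ht.1)
    have hu : IntegrableOn (fun s => VF A (h s) u) (Ioc 0 1) :=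
      VF_integrable A hA h (fun _ => u) 1 hh continuousOn_const ‖u‖ (fun _ _ => le_rfl)
    have h2 : IntegrableOn (fun s => VF A (h s) (φ s)) (Ioc τ 1) := by
      refine (hu.mono_set (Ioc_subset_Ioc_left hτ0)).congr_fun ?_ measurableSet_Ioc
      intro s hs
      simp only [hgt s hs]
    rw [← Ioc_union_Ioc_eq_Ioc hτ0 hτ1]
    exact IntegrableOn.union hGτ h2
  refine ⟨τ, ?_, hτ1, fun s _ hs => hlt s hs, hGτ, fun t ht => ?_⟩
  · rcases hτ0.eq_or_lt with h | h
    · exact absurd (by rw [← h]; exact hS0.2) hGτ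
    · exact h
  · exact Gu t ⟨hτ0.trans ht.1, ht.2⟩ fun hG => hGτ (Gmono _ _ ht.1 hG)

/-- If the trajectory of `h` explodes at time `τ`, then any control that is a reparametrization of
`h` on `[0, σ 1]` has a trajectory determined by that of `h`. -/
theorem blowup_same {NP d : ℕ} {A : Fin d → EucSp NP → EucSp NP} {u : EucSp NP}
    (hA : ∀ i, ContDiff ℝ (⊤ : ℕ∞) (A i))
    {h H : ℝ → EucSp d} {φ Ψ : ℝ → EucSp NP}
    (hh : IntegrableOn h (Ioc 0 1)) (hH : IntegrableOn H (Ioc 0 1))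
    (hφ : ∀ t ∈ Icc (0:ℝ) 1, φ t = u + ∫ s in Ioc (0:ℝ) t, VF A (h s) (φ s))
    (hΨ : ∀ t ∈ Icc (0:ℝ) 1, Ψ t = u + ∫ s in Ioc (0:ℝ) t, VF A (H s) (Ψ s))
    (w : ℝ → ℝ) (c : ℝ) (hc : 0 < c) (hcw : ∀ t, c ≤ w t)
    (hw : LocallyIntegrable w volume) (σ : ℝ ≃o ℝ) (h0 : σ 0 = 0) (h1 : σ 1 ≤ 1)
    (hmap : Measure.map σ (volume.withDensity (fun x => ((w x).toNNReal : ENNReal))) = volume)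
    (hHh : ∀ᵐ r ∂(volume.restrict (Ioc 0 (σ 1))), (w (σ.symm r))⁻¹ • h (σ.symm r) = H r)
    (τ : ℝ) (hτ0 : 0 < τ) (hτ1 : τ ≤ 1)
    (hG : ∀ s, 0 ≤ s → s < τ → IntegrableOn (fun s => VF A (h s) (φ s)) (Ioc 0 s))
    (hGτ : ¬ IntegrableOn (fun s => VF A (h s) (φ s)) (Ioc 0 τ)) :
    ∀ r ∈ Icc (0:ℝ) 1, Ψ r = if r < σ τ then φ (σ.symm r) else u := by
  have hστ1 : σ τ ≤ 1 := (σ.monotone hτ1).trans h1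
  have hσ0 : ∀ t, 0 ≤ t → 0 ≤ σ t := fun t ht => by rw [← h0]; exact σ.monotone ht
  -- comparison on a common interval of existence
  have hcmp : ∀ t, 0 ≤ t → t < τ → IntegrableOn (fun s => VF A (H s) (Ψ s)) (Ioc 0 (σ t)) →
      ∀ r ∈ Icc 0 (σ t), Ψ r = φ (σ.symm r) := by
    intro t ht htτ hGt
    have hσt1 : σ t ≤ 1 := (σ.monotone htτ.le).trans hστ1
    have s1 := Phi_isSol_of_int hΨ (σ t) hσt1 hGt
    have s2 := (Phi_isSol_of_int hφ t (htτ.le.trans hτ1) (hG t ht htτ)).reparam w c hc hcw hw σ h0 hmap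
    refine s1.unique hA (hH.mono_set (Ioc_subset_Ioc_right hσt1)) s2 ?_
    have := ae_restrict_of_ae_restrict_of_subset
      (Ioc_subset_Ioc_right (σ.monotone (htτ.le.trans hτ1))) hHh
    filter_upwards [this] with r hr
    exact hr.symm
  have hnot : ¬ IntegrableOn (fun s => VF A (H s) (Ψ s)) (Ioc 0 (σ τ)) := by
    intro hGH
    have s1 := Phi_isSol_of_int hΨ (σ τ) hστ1 hGH
    obtain ⟨R, hR⟩ := s1.1.exists_norm_le_Icc
    refine hGτ (ext_int hA hh hφ τ hτ1 hG R ?_)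
    intro s hs
    have h2 := hcmp s hs.1.le hs.2
      (hGH.mono_set (Ioc_subset_Ioc_right (σ.monotone hs.2.le))) (σ s) ⟨hσ0 s hs.1.le, le_rfl⟩
    rw [OrderIso.symm_apply_apply] at h2
    rw [← h2]
    exact hR _ ⟨hσ0 s hs.1.le, σ.monotone hs.2.le⟩
  obtain ⟨τ', hτ'0, hτ'1, hG', hGτ', hu'⟩ := blowup hA hH hΨ
    (fun hI => hnot (hI.mono_set (Ioc_subset_Ioc_right hστ1)))
  have hle : τ' ≤ σ τ := by
    by_contra hcon
    exact hnot (hG' _ (hσ0 τ hτ0.le) (not_le.1 hcon))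
  have hge : σ τ ≤ τ' := by
    by_contra hcon
    push Not at hcon
    have ht' : σ.symm τ' < τ := by rw [OrderIso.symm_apply_lt]; exact hcon
    have ht'0 : 0 ≤ σ.symm τ' := by rw [OrderIso.le_symm_apply, h0]; exact hτ'0.le
    have s2 := Phi_isSol_of_int hφ _ (ht'.le.trans hτ1) (hG _ ht'0 ht')
    obtain ⟨R, hR⟩ := s2.1.exists_norm_le_Icc
    refine hGτ' (ext_int hA hH hΨ τ' hτ'1 hG' R ?_)
    intro r hr
    have hr0 : 0 ≤ σ.symm r := by rw [OrderIso.le_symm_apply, h0]; exact hr.1.le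
    have hr1 : σ.symm r < σ.symm τ' := σ.symm.strictMono hr.2
    have h2 := hcmp (σ.symm r) hr0 (hr1.trans ht')
      (by rw [OrderIso.apply_symm_apply]; exact hG' r hr.1.le hr.2) r
      ⟨hr.1.le, by rw [OrderIso.apply_symm_apply]⟩
    rw [h2]
    exact hR _ ⟨hr0, hr1.le⟩
  have heq : τ' = σ τ := le_antisymm hle hge
  intro r hr
  split_ifs with hrτ
  · have hr0 : 0 ≤ σ.symm r := by rw [OrderIso.le_symm_apply, h0]; exact hr.1
    exact hcmp (σ.symm r) hr0 (by rw [OrderIso.symm_apply_lt]; exact hrτ)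
      (by rw [OrderIso.apply_symm_apply]; exact hG' r hr.1 (heq ▸ hrτ)) r
      ⟨hr.1, by rw [OrderIso.apply_symm_apply]⟩
  · exact hu' r ⟨by rw [heq]; exact not_lt.1 hrτ, hr.2⟩

/-- No explosion, from the energy identity. -/
theorem no_blowup {NP d : ℕ} {A : Fin d → EucSp NP → EucSp NP} {u : EucSp NP}
    (hA : ∀ i, ContDiff ℝ (⊤ : ℕ∞) (A i)) (Φ : CM d → ℝ → EucSp NP)
    (hΦ : ∀ h : CM d, ∀ t ∈ Icc (0:ℝ) 1, Φ h t = u + ∫ s in Ioc (0:ℝ) t, VF A (h s) (Φ h s))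
    (hE : ∀ h k : CM d, (∀ t ∈ Icc (0:ℝ) 1, Φ h t = Φ k t) → ‖h‖ = ‖k‖) (h : CM d) :
    IsSol A u h (Φ h) 1 := by
  refine Phi_isSol_of_int (hΦ h) 1 le_rfl ?_
  rcases subsingleton_or_nontrivial (EucSp d) with hsub | hnt
  · have : ∀ s, VF A (h s) (Φ h s) = 0 := by
      intro s
      rw [Subsingleton.elim (h s) 0]
      simp [VF]
    simp [this]
  obtain ⟨e, he⟩ := exists_ne (0 : EucSp d)
  by_contra hn
  obtain ⟨τ, hτ0, hτ1, hG, hGτ, -⟩ := blowup hA (CM_integrable h) (hΦ h) hn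
  let w : ℝ → ℝ := fun _ => 1 / 2
  have hw : LocallyIntegrable w volume := locallyIntegrable_const _
  obtain ⟨σ, h0, hσ, hmap⟩ := exists_reparam w (1/2) (by norm_num) (fun _ => le_rfl) hw
  have hσ1 : σ 1 = 1 / 2 := by rw [hσ 1 zero_le_one]; simp [w]
  have h1 : σ 1 ≤ 1 := by rw [hσ1]; norm_num
  obtain ⟨H, hH, -⟩ := CM_reparam h w (1/2) (by norm_num) (fun _ => le_rfl) measurable_const hw σ h0 h1 hmap
  let I : CM d := indicatorConstLp 2 (measurableSet_Ioc (a := (1/2:ℝ)) (b := 1))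
    (measure_ne_top μ01 _) e
  have hI0 : ∀ᵐ r ∂(volume.restrict (Ioc (0:ℝ) (σ 1))), I r = 0 := by
    have h2 : ∀ᵐ r ∂(volume.restrict (Ioc (0:ℝ) 1)), r ∉ Ioc (1/2:ℝ) 1 → I r = 0 :=
      indicatorConstLp_coeFn_notMem
    filter_upwards [ae_restrict_of_ae_restrict_of_subset (Ioc_subset_Ioc_right h1) h2,
      ae_restrict_mem measurableSet_Ioc] with r hr hr'
    refine hr fun hcon => ?_
    rw [hσ1] at hr'
    exact absurd hcon.1 (not_lt.2 hr'.2)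
  have hall : ∀ K : CM d, (∀ᵐ r ∂(volume.restrict (Ioc (0:ℝ) (σ 1))), K r = H r) → ‖K‖ = ‖H‖ := by
    intro K hK
    have hK' : ∀ᵐ r ∂(volume.restrict (Ioc 0 (σ 1))), (w (σ.symm r))⁻¹ • h (σ.symm r) = K r := by
      filter_upwards [hK, hH] with r h3 h4
      rw [h3, h4]
    refine hE K H fun t ht => ?_
    rw [blowup_same hA (CM_integrable h) (CM_integrable K) (hΦ h) (hΦ K) w (1/2) (by norm_num)
        (fun _ => le_rfl) hw σ h0 h1 hmap hK' τ hτ0 hτ1 hG hGτ t ht,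
      blowup_same hA (CM_integrable h) (CM_integrable H) (hΦ h) (hΦ H) w (1/2) (by norm_num)
        (fun _ => le_rfl) hw σ h0 h1 hmap hH τ hτ0 hτ1 hG hGτ t ht]
  have n1 : ‖H + I‖ = ‖H‖ := by
    refine hall _ ?_
    have h2 : ∀ᵐ r ∂(volume.restrict (Ioc (0:ℝ) 1)), (H + I : CM d) r = H r + I r :=
      Lp.coeFn_add H I
    filter_upwards [ae_restrict_of_ae_restrict_of_subset (Ioc_subset_Ioc_right h1) h2, hI0]
      with r h3 h4
    rw [h3, h4, add_zero]
  have n2 : ‖H - I‖ = ‖H‖ := by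
    refine hall _ ?_
    have h2 : ∀ᵐ r ∂(volume.restrict (Ioc (0:ℝ) 1)), (H - I : CM d) r = H r - I r :=
      Lp.coeFn_sub H I
    filter_upwards [ae_restrict_of_ae_restrict_of_subset (Ioc_subset_Ioc_right h1) h2, hI0]
      with r h3 h4
    rw [h3, h4, sub_zero]
  have hpar := parallelogram_law_with_norm ℝ H I
  rw [n1, n2] at hpar
  have hIn : ‖I‖ = 0 := by nlinarith [norm_nonneg I]
  have hμ : μ01.real (Ioc (1/2:ℝ) 1) = 1 / 2 := by
    unfold μ01 Measure.real
    rw [Measure.restrict_apply measurableSet_Ioc, Ioc_inter_Ioc]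
    norm_num
  have hIn' : ‖I‖ = ‖e‖ * μ01.real (Ioc (1/2:ℝ) 1) ^ (1 / (2 : ENNReal).toReal) :=
    norm_indicatorConstLp two_ne_zero (by simp)
  rw [hIn, hμ] at hIn'
  have : 0 < ‖e‖ * (1 / 2 : ℝ) ^ (1 / (2 : ENNReal).toReal) := by
    have := norm_pos_iff.2 he
    positivity
  linarith

/-! ### Part 5: weak continuity of the skeleton map -/

theorem VF_add {d NP : ℕ} (A : Fin d → EucSp NP → EucSp NP) (a b : EucSp d) (y : EucSp NP) :
    VF A (a + b) y = VF A a y + VF A b y := by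
  simp [VF, add_smul, Finset.sum_add_distrib]

theorem VF_sub {d NP : ℕ} (A : Fin d → EucSp NP → EucSp NP) (a b : EucSp d) (y : EucSp NP) :
    VF A (a - b) y = VF A a y - VF A b y := by
  simp [VF, sub_smul, Finset.sum_sub_distrib]

theorem exists_Lam {d NP : ℕ} (A : Fin d → EucSp NP → EucSp NP)
    (hA : ∀ i, ContDiff ℝ (⊤ : ℕ∞) (A i)) (ψ : ℝ → EucSp NP) (hψ : ContinuousOn ψ (Icc 0 1))
    (t : ℝ) (ht : t ≤ 1) :
    ∃ L : CM d →L[ℝ] EucSp NP, ∀ k : CM d, L k = ∫ s in Ioc 0 t, VF A (k s) (ψ s) := by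
  obtain ⟨R, hR⟩ := hψ.exists_norm_le_Icc
  obtain ⟨C, hC0, hC, -⟩ := exists_lip_const A hA R
  have hI : ∀ k : CM d, IntegrableOn (fun s => VF A (k s) (ψ s)) (Ioc 0 t) := fun k =>
    (VF_integrable A hA k ψ 1 (CM_integrable k) (hψ.mono Ioo_subset_Icc_self) R
      (fun t ht => hR t (Ioo_subset_Icc_self ht))).mono_set (Ioc_subset_Ioc_right ht)
  let L₀ : CM d →ₗ[ℝ] EucSp NP :=
    { toFun := fun k => ∫ s in Ioc 0 t, VF A (k s) (ψ s)
      map_add' := by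
        intro k l
        rw [← integral_add (hI k) (hI l)]
        refine integral_congr_ae ?_
        have h2 : ∀ᵐ r ∂(volume.restrict (Ioc (0:ℝ) 1)), (k + l : CM d) r = k r + l r :=
          Lp.coeFn_add k l
        filter_upwards [ae_restrict_of_ae_restrict_of_subset (Ioc_subset_Ioc_right ht) h2] with s hs
        rw [hs, VF_add]
      map_smul' := by
        intro a k
        rw [RingHom.id_apply, ← integral_smul]
        refine integral_congr_ae ?_
        have h2 : ∀ᵐ r ∂(volume.restrict (Ioc (0:ℝ) 1)), (a • k : CM d) r = a • k r :=
          Lp.coeFn_smul a k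
        filter_upwards [ae_restrict_of_ae_restrict_of_subset (Ioc_subset_Ioc_right ht) h2] with s hs
        rw [hs, VF_smul] }
  refine ⟨L₀.mkContinuous C ?_, fun k => rfl⟩
  intro k
  show ‖∫ s in Ioc 0 t, VF A (k s) (ψ s)‖ ≤ C * ‖k‖
  have h1 : ‖∫ s in Ioc 0 t, VF A (k s) (ψ s)‖ ≤ ∫ s in Ioc 0 t, C * ‖k s‖ := by
    refine norm_integral_le_of_norm_le
      (((CM_integrable k).mono_set (Ioc_subset_Ioc_right ht)).norm.const_mul C) ?_
    filter_upwards [ae_restrict_mem measurableSet_Ioc] with s hs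
    exact VF_norm_le A _ _ C (hC _ (hR s ⟨hs.1.le, hs.2.trans ht⟩))
  refine h1.trans ?_
  rw [integral_const_mul]
  gcongr
  exact CM_L1_le_of_le k t ht

theorem Lam_uniform {d NP : ℕ} {ι : Type*} (l : Filter ι) (A : Fin d → EucSp NP → EucSp NP)
    (hA : ∀ i, ContDiff ℝ (⊤ : ℕ∞) (A i)) (ψ : ℝ → EucSp NP) (hψ : ContinuousOn ψ (Icc 0 1))
    (k : ι → CM d) (B : ℝ) (hB : ∀ n, ‖k n‖ ≤ B)
    (hk : ∀ L : CM d →L[ℝ] ℝ, Filter.Tendsto (fun n => L (k n)) l (nhds 0))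
    (ε : ℝ) (hε : 0 < ε) :
    ∀ᶠ n in l, ∀ t ∈ Icc (0:ℝ) 1, ‖∫ s in Ioc 0 t, VF A (k n s) (ψ s)‖ ≤ ε := by
  obtain ⟨R, hR⟩ := hψ.exists_norm_le_Icc
  obtain ⟨C, hC0, hC, -⟩ := exists_lip_const A hA R
  have hpt : ∀ t ≤ 1, Filter.Tendsto (fun n => ‖∫ s in Ioc 0 t, VF A (k n s) (ψ s)‖) l (nhds 0) := by
    intro t ht
    obtain ⟨L, hL⟩ := exists_Lam A hA ψ hψ t ht
    simp only [← hL]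
    rw [← tendsto_zero_iff_norm_tendsto_zero]
    have h1 : Filter.Tendsto (fun n => (EuclideanSpace.equiv (Fin NP) ℝ) (L (k n))) l (nhds 0) := by
      rw [tendsto_pi_nhds]
      intro j
      exact hk ((EuclideanSpace.proj (𝕜 := ℝ) j).comp L)
    have h2 := ((EuclideanSpace.equiv (Fin NP) ℝ).symm.continuous.tendsto 0).comp h1
    simpa [Function.comp_def] using h2
  have hI : ∀ n, IntegrableOn (fun s => VF A (k n s) (ψ s)) (Ioc 0 1) := fun n =>
    (VF_integrable A hA (k n) ψ 1 (CM_integrable _) (hψ.mono Ioo_subset_Icc_self) R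
      (fun t ht => hR t (Ioo_subset_Icc_self ht)))
  -- equicontinuity
  obtain ⟨a, ha, haε⟩ : ∃ a : ℝ, 0 < a ∧ C * (B ^ 2 / a) / 2 ≤ ε / 4 := by
    refine ⟨2 * C * B ^ 2 / ε + 1, by positivity, ?_⟩
    have hp : 0 < 2 * C * B ^ 2 / ε + 1 := by positivity
    have : C * (B ^ 2 / (2 * C * B ^ 2 / ε + 1)) = C * B ^ 2 / (2 * C * B ^ 2 / ε + 1) := by ring
    rw [this, div_div, div_le_iff₀ (by positivity)]
    have h3 : ε * (2 * C * B ^ 2 / ε) = 2 * C * B ^ 2 := by field_simp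
    nlinarith
  obtain ⟨N, hN⟩ := exists_nat_gt (2 * C * a / ε + 1)
  have hN0 : (0:ℝ) < N := lt_trans (by positivity) hN
  have hN' : C * (a * (1 / N)) / 2 ≤ ε / 4 := by
    have h3 : ε * (2 * C * a / ε) = 2 * C * a := by field_simp
    have : C * (a * (1 / N)) / 2 = (C * a) / (N * 2) := by field_simp
    rw [this, div_le_iff₀ (by positivity)]
    nlinarith
  have hequi : ∀ n, ∀ s t : ℝ, 0 ≤ s → s ≤ t → t ≤ 1 → t - s ≤ 1 / N →
      ‖∫ r in Ioc 0 t, VF A (k n r) (ψ r)‖ ≤ ‖∫ r in Ioc 0 s, VF A (k n r) (ψ r)‖ + ε / 2 := by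
    intro n s t hs hst ht hts
    have hsp : ∫ r in Ioc 0 t, VF A (k n r) (ψ r) = (∫ r in Ioc 0 s, VF A (k n r) (ψ r)) +
        ∫ r in Ioc s t, VF A (k n r) (ψ r) := by
      rw [← Ioc_union_Ioc_eq_Ioc hs hst]
      refine setIntegral_union (Ioc_disjoint_Ioc_of_le le_rfl) measurableSet_Ioc
        ((hI n).mono_set (Ioc_subset_Ioc_right (hst.trans ht)))
        ((hI n).mono_set (Ioc_subset_Ioc hs ht))
    rw [hsp]
    refine (norm_add_le _ _).trans (add_le_add le_rfl ?_)
    have h1 : ‖∫ r in Ioc s t, VF A (k n r) (ψ r)‖ ≤ ∫ r in Ioc s t, C * ‖k n r‖ := by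
      refine norm_integral_le_of_norm_le
        (((CM_integrable (k n)).mono_set (Ioc_subset_Ioc hs ht)).norm.const_mul C) ?_
      filter_upwards [ae_restrict_mem measurableSet_Ioc] with r hr
      exact VF_norm_le A _ _ C (hC _ (hR r ⟨hs.trans hr.1.le, hr.2.trans ht⟩))
    rw [integral_const_mul] at h1
    have h2 := CM_integral_le (k n) s t a hs hst ht ha
    have h3 : ‖k n‖ ^ 2 ≤ B ^ 2 := by gcongr; exact hB n
    have h4 : (a * (t - s) + ‖k n‖ ^ 2 / a) / 2 ≤ (a * (1 / N) + B ^ 2 / a) / 2 := by gcongr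
    have h5 := mul_le_mul_of_nonneg_left (h2.trans h4) hC0
    have h6 : C * ((a * (1 / N) + B ^ 2 / a) / 2) = C * (a * (1 / N)) / 2 + C * (B ^ 2 / a) / 2 := by
      ring
    linarith
  have hgrid : ∀ᶠ n in l, ∀ j ∈ Finset.range (N + 1),
      ‖∫ s in Ioc 0 ((j:ℝ) / N), VF A (k n s) (ψ s)‖ ≤ ε / 2 := by
    rw [Filter.eventually_all_finset]
    intro j hj
    have hj' : (j:ℝ) / N ≤ 1 := by
      rw [div_le_one hN0]
      exact_mod_cast Nat.lt_succ_iff.1 (Finset.mem_range.1 hj)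
    filter_upwards [(hpt _ hj').eventually (gt_mem_nhds (half_pos hε))] with n hn
    exact hn.le
  filter_upwards [hgrid] with n hn t ht
  have hf1 : (⌊t * N⌋₊ : ℝ) ≤ t * N := Nat.floor_le (mul_nonneg ht.1 hN0.le)
  have hf2 : t * N < ⌊t * N⌋₊ + 1 := Nat.lt_floor_add_one _
  have hmem : ⌊t * N⌋₊ ∈ Finset.range (N + 1) := by
    rw [Finset.mem_range, Nat.lt_succ_iff]
    have : (⌊t * N⌋₊ : ℝ) ≤ N := hf1.trans (by nlinarith [ht.2])
    exact_mod_cast this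
  have h1 := hn _ hmem
  have h2 := hequi n ((⌊t * N⌋₊ : ℝ) / N) t (by positivity)
    (by rw [div_le_iff₀ hN0]; exact hf1) ht.2 (by
      rw [sub_le_iff_le_add, ← add_div, le_div_iff₀ hN0]; linarith)
  linarith

theorem weak_cont {d NP : ℕ} {ι : Type*} (l : Filter ι) (A : Fin d → EucSp NP → EucSp NP)
    (hA : ∀ i, ContDiff ℝ (⊤ : ℕ∞) (A i)) (u : EucSp NP) (Φ : CM d → ℝ → EucSp NP)
    (hΦ : ∀ h : CM d, IsSol A u h (Φ h) 1) (x : ι → CM d) (h : CM d) (B : ℝ)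
    (hB : ∀ n, ‖x n‖ ≤ B)
    (hx : ∀ L : CM d →L[ℝ] ℝ, Filter.Tendsto (fun n => L (x n)) l (nhds (L h))) :
    Filter.Tendsto (fun n => Φ (x n) 1) l (nhds (Φ h 1)) := by
  obtain ⟨R, hR⟩ := (hΦ h).1.exists_norm_le_Icc
  obtain ⟨C, hC0, -, hC⟩ := exists_lip_const A hA (R + 1)
  set E := Real.exp (2 * (C * B + 1)) with hE
  have hE0 : 0 < E := Real.exp_pos _
  rw [Metric.tendsto_nhds]
  intro η hη
  have hmin : 0 < min η 1 := lt_min hη one_pos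
  have hε : 0 < min η 1 / (4 * E) := by positivity
  have huni := Lam_uniform l A hA (Φ h) (hΦ h).1 (fun n => x n - h) (B + ‖h‖)
    (fun n => (norm_sub_le _ _).trans (by gcongr; exact hB n))
    (fun L => by
      have := (hx L).sub_const (L h)
      simpa using this) _ hε
  filter_upwards [huni] with n hn
  have hbound : 2 * (min η 1 / (4 * E)) *
      Real.exp (2 * (C * (∫ s in Ioc (0:ℝ) 1, ‖x n s‖) + 1)) < min η 1 := by
    have h1 : Real.exp (2 * (C * (∫ s in Ioc (0:ℝ) 1, ‖x n s‖) + 1)) ≤ E := by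
      have := (CM_L1_le (x n)).trans (hB n)
      rw [hE]
      gcongr
    calc _ ≤ 2 * (min η 1 / (4 * E)) * E := by gcongr
      _ = min η 1 / 2 := by field_simp; ring
      _ < _ := by linarith
  have hst := stability hA zero_le_one (CM_integrable (x n)) (CM_integrable h) (hΦ (x n)) (hΦ h)
    R C (min η 1 / (4 * E)) hC0 hR hC (by
      intro t ht
      refine le_trans (le_of_eq ?_) (hn t ht)
      congr 1
      refine integral_congr_ae ?_
      have h2 : ∀ᵐ r ∂(volume.restrict (Ioc (0:ℝ) 1)), (x n - h : CM d) r = x n r - h r :=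
        Lp.coeFn_sub _ _
      filter_upwards [ae_restrict_of_ae_restrict_of_subset (Ioc_subset_Ioc_right ht.2) h2] with s hs
      rw [hs, VF_sub]) (hbound.trans_le (min_le_right _ _)) 1 ⟨zero_le_one, le_rfl⟩
  rw [dist_eq_norm]
  exact hst.trans_lt (hbound.trans_le (min_le_left _ _))

/-! ### Part 6: admissible paths -/

theorem g_zero {N : ℕ} (S : SRData N) (x : EucSp N) : S.g x 0 0 = 0 := by
  have := S.g_smull x 0 0 0
  simpa using this

/-- If `q` is `p` stopped at time `s`, then its energy density is that of `p`, cut off at `s`. -/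
theorem adm_trunc {N : ℕ} {S : SRData N} {x y y' : EucSp N} (p : AdmPath S x y)
    (q : AdmPath S x y') (s : ℝ) (hs0 : 0 ≤ s)
    (h : ∀ t ∈ Icc (0:ℝ) 1, q.γ t = p.γ (min t s)) :
    ∀ᵐ t ∂(volume.restrict (Ioc (0:ℝ) 1)), S.g (q.γ t) (q.v t) (q.v t) =
      (Ioc 0 s).indicator (fun t => S.g (p.γ t) (p.v t) (p.v t)) t := by
  have hv : ∀ᵐ t ∂(volume.restrict (Ioc (0:ℝ) 1)), q.v t = (Ioc 0 s).indicator p.v t := by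
    refine ae_eq_of_primitive_eq _ _ 1 q.vInt (p.vInt.indicator measurableSet_Ioc) ?_
    intro t ht
    rw [setIntegral_indicator measurableSet_Ioc, Ioc_inter_Ioc, max_self]
    have h1 := q.rep t ht
    have h2 := p.rep (min t s) ⟨le_min ht.1 hs0, (min_le_left _ _).trans ht.2⟩
    rw [h t ht, h2] at h1
    exact (add_left_cancel h1).symm
  filter_upwards [hv, ae_restrict_mem measurableSet_Ioc] with t ht htm
  rw [ht]
  by_cases hts : t ∈ Ioc 0 s
  · rw [indicator_of_mem hts, indicator_of_mem hts, h t ⟨htm.1.le, htm.2⟩, min_eq_left hts.2]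
  · rw [indicator_of_notMem hts, indicator_of_notMem hts, g_zero]

theorem adm_eq {N : ℕ} {S : SRData N} {x y y' : EucSp N} (p : AdmPath S x y)
    (q : AdmPath S x y') (h : ∀ t ∈ Icc (0:ℝ) 1, q.γ t = p.γ t) :
    ∀ᵐ t ∂(volume.restrict (Ioc (0:ℝ) 1)), S.g (q.γ t) (q.v t) (q.v t) =
      S.g (p.γ t) (p.v t) (p.v t) := by
  filter_upwards [adm_trunc p q 1 zero_le_one (fun t ht => by rw [min_eq_left ht.2, h t ht]),
    ae_restrict_mem measurableSet_Ioc] with t ht htm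
  rw [ht, indicator_of_mem htm]

/-! ### Part 7: conclusion -/

/-- Constant speed reparametrisation. -/
theorem const_speed {d NP : ℕ} {A : Fin d → EucSp NP → EucSp NP} {u : EucSp NP}
    (hA : ∀ i, ContDiff ℝ (⊤ : ℕ∞) (A i)) (Φ : CM d → ℝ → EucSp NP)
    (hsol : ∀ h : CM d, IsSol A u h (Φ h) 1) (h : CM d) (ε : ℝ) (hε : 0 < ε) :
    ∃ H : CM d, Φ H 1 = Φ h 1 ∧ ‖H‖ ^ 2 ≤
      ((∫ s in Ioc (0:ℝ) 1, ‖h s‖) + ε) * ∫ s in Ioc (0:ℝ) 1, ‖h s‖ := by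
  set ℓ := ∫ s in Ioc (0:ℝ) 1, ‖h s‖ with hℓ
  have hℓ0 : 0 ≤ ℓ := integral_nonneg fun _ => norm_nonneg _
  have hpos : 0 < ℓ + ε := by linarith
  have hint : IntegrableOn (fun s => ‖h s‖) (Ioc (0:ℝ) 1) := (CM_integrable h).norm
  let w : ℝ → ℝ := fun s => ((Ioc (0:ℝ) 1).indicator (fun s => ‖h s‖) s + ε) / (ℓ + ε)
  have hind0 : ∀ s, 0 ≤ (Ioc (0:ℝ) 1).indicator (fun s => ‖h s‖) s := fun s =>
    indicator_nonneg (fun _ _ => norm_nonneg _) s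
  have hc : 0 < ε / (ℓ + ε) := by positivity
  have hcw : ∀ t, ε / (ℓ + ε) ≤ w t := by
    intro t
    have := hind0 t
    simp only [w]
    gcongr
    linarith
  have hwm : Measurable w := by
    have h1 : Measurable (fun s => ‖h s‖) := (Lp.stronglyMeasurable h).measurable.norm
    exact ((h1.indicator measurableSet_Ioc).add_const _).div_const _
  have hw : LocallyIntegrable w volume := by
    have h1 : LocallyIntegrable ((Ioc (0:ℝ) 1).indicator (fun s => ‖h s‖)) volume :=
      ((integrable_indicator_iff measurableSet_Ioc).2 hint).locallyIntegrable
    have h2 := (h1.add (locallyIntegrable_const ε)).smul ((ℓ + ε)⁻¹)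
    refine h2.congr (Filter.Eventually.of_forall fun s => ?_)
    simp [w, div_eq_inv_mul]
  obtain ⟨σ, h0, hσ, hmap⟩ := exists_reparam w _ hc hcw hw
  have hσ1 : σ 1 = 1 := by
    rw [hσ 1 zero_le_one]
    have : ∫ s in Ioc (0:ℝ) 1, w s = ∫ s in Ioc (0:ℝ) 1, (‖h s‖ + ε) / (ℓ + ε) := by
      refine setIntegral_congr_fun measurableSet_Ioc fun s hs => ?_
      simp only [w]
      rw [indicator_of_mem hs]
    rw [this, integral_div, integral_add hint (integrableOn_const (by simp))]
    simp only [setIntegral_const, ← hℓ]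
    simp
    exact hpos.ne'
  obtain ⟨H, hH, hHn⟩ := CM_reparam h w _ hc hcw hwm hw σ h0 hσ1.le hmap
  refine ⟨H, ?_, ?_⟩
  · have h2 := (hsol h).reparam w _ hc hcw hw σ h0 hmap
    rw [hσ1] at h2 hH
    have h3 := IsSol.unique hA (CM_integrable H) (hsol H) h2
      (by filter_upwards [hH] with s hs using hs.symm) 1 ⟨zero_le_one, le_rfl⟩
    have h4 : σ.symm 1 = 1 := by rw [OrderIso.symm_apply_eq, hσ1]
    rw [h3, h4]
  · rw [hHn, ← integral_const_mul]
    refine integral_mono_of_nonneg (Filter.Eventually.of_forall fun s => ?_)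
      (hint.const_mul _) ?_
    · exact mul_nonneg (inv_nonneg.2 (hc.le.trans (hcw s))) (sq_nonneg _)
    · filter_upwards [ae_restrict_mem measurableSet_Ioc] with s hs
      simp only [w]
      rw [indicator_of_mem hs, inv_div]
      have hn := norm_nonneg (h s)
      have hn2 : 0 < ‖h s‖ + ε := by linarith
      rw [div_mul_eq_mul_div, div_le_iff₀ hn2]
      have h5 : 0 ≤ (ℓ + ε) * ‖h s‖ * ε := mul_nonneg (mul_nonneg hpos.le hn) hε.le
      have h6 : (ℓ + ε) * ‖h s‖ * (‖h s‖ + ε) =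
        (ℓ + ε) * ‖h s‖ ^ 2 + (ℓ + ε) * ‖h s‖ * ε := by ring
      rw [h6]
      exact le_add_of_nonneg_right h5

theorem statement16 {NP N d : ℕ} (S : SRData N)
    (π : EucSp NP → EucSp N) (hπ : ContDiff ℝ (⊤ : ℕ∞) π)
    (A : Fin d → EucSp NP → EucSp NP) (hA : ∀ i, ContDiff ℝ (⊤ : ℕ∞) (A i))
    (u : EucSp NP) (hu : π u ∈ S.M) (a : EucSp N) (ha : a ∈ S.M)
    -- `Φ h` solves the skeleton ODE `dφ = Σ A_i(φ) dh^i`, `φ_0 = u`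
    (Φ : CM d → ℝ → EucSp NP)
    (hΦ : ∀ h : CM d, Φ h 0 = u ∧
      ∀ t ∈ Set.Icc (0:ℝ) 1,
        Φ h t = u + ∫ s in Set.Ioc (0:ℝ) t, ∑ i, (h s i) • A i (Φ h s))
    -- the development map `h ↦ ψ(h) = π ∘ Φ(h)` is an energy-preserving bijection
    -- from `H^d` onto `H_{π u}(M, D)` (Proposition `pr.iso_path` of the paper):
    (hdev : ∀ h : CM d, ∃ p : AdmPath S (π u) (π (Φ h 1)),
        (∀ t ∈ Set.Icc (0:ℝ) 1, p.γ t = π (Φ h t)) ∧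
        p.energy = ‖h‖ ^ 2)
    (hsurj : ∀ y : EucSp N, ∀ q : AdmPath S (π u) y,
        ∃ h : CM d, ∀ t ∈ Set.Icc (0:ℝ) 1, π (Φ h t) = q.γ t)
    -- Chow–Rashevsky: any two points of `M` are joined by an admissible path
    (hChow : ∀ y ∈ S.M, ∀ z ∈ S.M, Nonempty (AdmPath S y z)) :
    Set.Nonempty {h : CM d | π (Φ h 1) = a} ∧
    ∃ h₀ ∈ {h : CM d | π (Φ h 1) = a},
      (∀ h ∈ {h : CM d | π (Φ h 1) = a}, ‖h₀‖ ^ 2 / 2 ≤ ‖h‖ ^ 2 / 2) ∧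
      ‖h₀‖ ^ 2 / 2 = dSR S (π u) a ^ 2 / 2 := by
  have hE : ∀ h k : CM d, (∀ t ∈ Icc (0:ℝ) 1, Φ h t = Φ k t) → ‖h‖ = ‖k‖ := by
    intro h k hhk
    obtain ⟨p, hp, hpe⟩ := hdev h
    obtain ⟨q, hq, hqe⟩ := hdev k
    have h1 := adm_eq p q (fun t ht => by rw [hp t ht, hq t ht, hhk t ht])
    have h2 : q.energy = p.energy := integral_congr_ae h1
    rw [hpe, hqe] at h2
    exact ((pow_left_inj₀ (norm_nonneg _) (norm_nonneg _) two_ne_zero).1 h2).symm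
  have hsol : ∀ h : CM d, IsSol A u h (Φ h) 1 :=
    no_blowup hA Φ (fun h => (hΦ h).2) hE
  have hspeed : ∀ (h : CM d) (y : EucSp N) (p : AdmPath S (π u) y),
      (∀ t ∈ Icc (0:ℝ) 1, p.γ t = π (Φ h t)) →
      ∀ᵐ t ∂(volume.restrict (Ioc (0:ℝ) 1)), S.g (p.γ t) (p.v t) (p.v t) = ‖h t‖ ^ 2 := by
    intro h y p hp
    refine ae_eq_of_primitive_eq _ _ 1 p.energyInt (CM_integrable_sq h) ?_
    intro s hs
    obtain ⟨k, hk, hkn⟩ := CM_trunc h s hs.2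
    obtain ⟨q, hq, hqe⟩ := hdev k
    have h1 := IsSol.unique hA (CM_integrable k) (hsol k) ((hsol h).trunc s hs.1)
      (by filter_upwards [hk] with t ht using ht.symm)
    have h2 := adm_trunc p q s hs.1 (fun t ht => by
      rw [hq t ht, h1 t ht, hp _ ⟨le_min ht.1 hs.1, (min_le_left _ _).trans ht.2⟩])
    have h3 : q.energy = _ := integral_congr_ae h2
    rw [setIntegral_indicator measurableSet_Ioc, Ioc_inter_Ioc, max_self, min_eq_right hs.2,
      hqe, hkn] at h3
    exact h3.symm
  have hlen : ∀ (h : CM d) (y : EucSp N) (p : AdmPath S (π u) y),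
      (∀ t ∈ Icc (0:ℝ) 1, p.γ t = π (Φ h t)) →
      p.length = ∫ s in Ioc (0:ℝ) 1, ‖h s‖ := by
    intro h y p hp
    refine integral_congr_ae ?_
    filter_upwards [hspeed h y p hp] with t ht
    rw [ht, Real.sqrt_sq (norm_nonneg _)]
  have hpath : ∀ q : AdmPath S (π u) a, ∃ h : CM d, π (Φ h 1) = a ∧
      q.length = ∫ s in Ioc (0:ℝ) 1, ‖h s‖ := by
    intro q
    obtain ⟨h, hh⟩ := hsurj a q
    exact ⟨h, by rw [hh 1 ⟨zero_le_one, le_rfl⟩, q.endpt],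
      hlen h a q (fun t ht => (hh t ht).symm)⟩
  have hne : Set.Nonempty {h : CM d | π (Φ h 1) = a} := by
    obtain ⟨q⟩ := hChow (π u) hu a ha
    obtain ⟨h, hh, -⟩ := hpath q
    exact ⟨h, hh⟩
  refine ⟨hne, ?_⟩
  obtain ⟨h₀, hh₀, hmin⟩ : ∃ h₀ : CM d, π (Φ h₀ 1) = a ∧
      ∀ h : CM d, π (Φ h 1) = a → ‖h₀‖ ≤ ‖h‖ := by
    let T : Set ℝ := (fun h : CM d => ‖h‖) '' {h : CM d | π (Φ h 1) = a}
    have hTne : T.Nonempty := hne.image _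
    have hTb : BddBelow T := ⟨0, by rintro _ ⟨h, -, rfl⟩; exact norm_nonneg _⟩
    have hm0 : 0 ≤ sInf T := Real.sInf_nonneg (by rintro _ ⟨h, -, rfl⟩; exact norm_nonneg _)
    have hseq : ∀ n : ℕ, ∃ h : CM d, π (Φ h 1) = a ∧ ‖h‖ < sInf T + 1 / ((n : ℝ) + 1) := by
      intro n
      obtain ⟨_, ⟨h, hh, rfl⟩, hlt⟩ := exists_lt_of_csInf_lt hTne
        (show sInf T < sInf T + 1 / ((n : ℝ) + 1) by
          have : 0 < 1 / ((n : ℝ) + 1) := by positivity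
          linarith)
      exact ⟨h, hh, hlt⟩
    choose x hxa hxn using hseq
    have hB : ∀ n, ‖x n‖ ≤ sInf T + 1 := by
      intro n
      have h1 : 1 / ((n : ℝ) + 1) ≤ 1 := by
        rw [div_le_one (by positivity)]
        have : (0:ℝ) ≤ n := by positivity
        linarith
      linarith [hxn n]
    obtain ⟨h₀, hw⟩ := weak_limit x _ hB (Filter.hyperfilter ℕ)
    have h1 := weak_cont _ A hA u Φ hsol x h₀ _ hB hw
    have h2 := (hπ.continuous.tendsto (Φ h₀ 1)).comp h1
    have h3 : π (Φ h₀ 1) = a := by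
      refine tendsto_nhds_unique h2 ?_
      have : (π ∘ fun n => Φ (x n) 1) = fun _ => a := funext hxa
      rw [this]
      exact tendsto_const_nhds
    have h4 : ‖h₀‖ ≤ sInf T := by
      have h5 := hw (innerSL ℝ h₀)
      simp only [innerSL_apply_apply, real_inner_self_eq_norm_sq] at h5
      have h6 : Filter.Tendsto (fun n : ℕ => ‖h₀‖ * (sInf T + 1 / ((n : ℝ) + 1)))
          (Filter.hyperfilter ℕ) (nhds (‖h₀‖ * (sInf T + 0))) :=
        ((tendsto_one_div_add_atTop_nhds_zero_nat.const_add _).const_mul _).mono_left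
          Nat.hyperfilter_le_atTop
      have h7 := le_of_tendsto_of_tendsto' h5 h6 (fun n =>
        (real_inner_le_norm _ _).trans (mul_le_mul_of_nonneg_left (hxn n).le (norm_nonneg _)))
      rcases (norm_nonneg h₀).eq_or_lt with h8 | h8
      · rw [← h8]; exact hm0
      · nlinarith
    exact ⟨h₀, h3, fun h hh => h4.trans (csInf_le hTb ⟨h, hh, rfl⟩)⟩
  have hL1 : ∀ h : CM d, π (Φ h 1) = a → ‖h₀‖ ≤ ∫ s in Ioc (0:ℝ) 1, ‖h s‖ := by
    intro h hh
    set ℓ := ∫ s in Ioc (0:ℝ) 1, ‖h s‖ with hℓ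
    have hℓ0 : 0 ≤ ℓ := integral_nonneg fun _ => norm_nonneg _
    refine le_of_forall_pos_le_add fun ε hε => ?_
    obtain ⟨H, hH1, hH2⟩ := const_speed hA Φ hsol h ε hε
    have h1 := hmin H (by rw [hH1, hh])
    have h2 : ‖H‖ ≤ ℓ + ε := by
      refine (sq_le_sq₀ (norm_nonneg _) (by linarith)).1 ?_
      rw [← hℓ] at hH2
      nlinarith
    linarith
  have hd : dSR S (π u) a = ‖h₀‖ := by
    have hlb : ∀ r ∈ {r | ∃ p : AdmPath S (π u) a, r = p.length}, ‖h₀‖ ≤ r := by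
      rintro _ ⟨p, rfl⟩
      obtain ⟨h, hh, hl⟩ := hpath p
      rw [hl]
      exact hL1 h hh
    refine le_antisymm ?_ ?_
    · have hex : ∃ p : AdmPath S (π u) a, ∀ t ∈ Icc (0:ℝ) 1, p.γ t = π (Φ h₀ t) := by
        have h1 := hdev h₀
        rw [hh₀] at h1
        obtain ⟨p, hp, -⟩ := h1
        exact ⟨p, hp⟩
      obtain ⟨p, hp⟩ := hex
      exact (csInf_le ⟨_, hlb⟩ ⟨p, rfl⟩).trans ((hlen h₀ a p hp).le.trans (CM_L1_le h₀))
    · obtain ⟨q⟩ := hChow (π u) hu a ha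
      exact le_csInf ⟨_, q, rfl⟩ hlb
  refine ⟨h₀, hh₀, fun h hh => ?_, by rw [hd]⟩
  have := hmin h hh
  have := norm_nonneg h₀
  gcongr
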